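/- arXiv:2404.10106 — 2 statements merged into one kernel-verified Lean document; each statement's English description precedes it below -/
import Mathlib

section
/- Central limit theorem for the mean-field approximated triangle count off the critical point (Theorem 3.7): Assume α > −2, (α,h) ≠ (27/8, ln 2 − 3/2), that g_{α,h} attains its maximum over [0,1] at a unique point u₀* ∈ (0,1), and that c₀ := (1 − 2α(u₀*)²(1−u₀*))/(4u₀*(1−u₀*)) > 0. Let m̄_n^Δ(α,h) = Σ_{m∈Γ_n} m³·ℙ̄_{n;α,h}({m}). Then the law of the random variable m ↦ n·(m³ − m̄_n^Δ(α,h))/√6 under ℙ̄_{n;α,h} converges weakly, as n → ∞, to the centered Gaussian distribution with variance v̄₀^Δ = 3(u₀*)⁴/(4c₀); equivalently, for every bounded continuous φ : ℝ → ℝ, Σ_{m∈Γ_n} φ(n·(m³ − m̄_n^Δ(α,h))/√6)·ℙ̄_{n;α,h}({m}) → ∫_ℝ φ(y)·(2π v̄₀^Δ)^{−1/2} exp(−y²/(2v̄₀^Δ)) dy. -/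
open scoped Classical
open Filter MeasureTheory

/-- The edge density `2k/n²` corresponding to `k` edges out of `n(n−1)/2`. -/
noncomputable def mfDensity (n k : ℕ) : ℝ := 2 * k / (n : ℝ) ^ 2

/-- Mean-field Gibbs weight `𝒩_m · exp(n²((α/6)m³ + (h/2)m))` for `m = 2k/n²`. -/
noncomputable def mfWeight (α h : ℝ) (n k : ℕ) : ℝ :=
  (Nat.choose (n * (n - 1) / 2) k : ℝ) *
    Real.exp ((n : ℝ) ^ 2 * (α / 6 * (mfDensity n k) ^ 3 + h / 2 * mfDensity n k))

/-- Mean-field partition function. -/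
noncomputable def mfZ (α h : ℝ) (n : ℕ) : ℝ :=
  ∑ k ∈ Finset.range (n * (n - 1) / 2 + 1), mfWeight α h n k

/-- Expectation of `f(m)` under the mean-field Gibbs measure on edge densities `Γ_n`. -/
noncomputable def mfExp (α h : ℝ) (n : ℕ) (f : ℝ → ℝ) : ℝ :=
  (∑ k ∈ Finset.range (n * (n - 1) / 2 + 1), f (mfDensity n k) * mfWeight α h n k) /
    mfZ α h n

/-- Probability of the event `{m ∈ Γ_n : m ∈ A}` under the mean-field Gibbs measure. -/
noncomputable def mfProb (α h : ℝ) (n : ℕ) (A : Set ℝ) : ℝ :=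
  (∑ k ∈ Finset.range (n * (n - 1) / 2 + 1),
      if mfDensity n k ∈ A then mfWeight α h n k else 0) / mfZ α h n

/-- The energy function `g_{α,h}(u) = (α/6)u³ + (h/2)u − I(u)/2`
(note `Real.log 0 = 0`, so the boundary convention `I(0)=I(1)=0` is automatic). -/
noncomputable def gFun (α h u : ℝ) : ℝ :=
  α / 6 * u ^ 3 + h / 2 * u - (u * Real.log u + (1 - u) * Real.log (1 - u)) / 2

open Real Topology Stirling

/-- The second-order Taylor quotient at a critical point tends to half the second derivative. -/
theorem tendsto_second_order_quotient {f f' : ℝ → ℝ} {a d : ℝ}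
    (hf : ∀ᶠ x in 𝓝 a, HasDerivAt f (f' x) x) (hf'a : f' a = 0) (hf' : HasDerivAt f' d a) :
    Tendsto (fun x => (f x - f a) / (x - a) ^ 2) (𝓝[≠] a) (𝓝 (d / 2)) := by
  refine HasDerivAt.lhopital_zero_nhdsNE (f' := f') (g' := fun x => 2 * (x - a)) ?_ ?_ ?_ ?_ ?_ ?_
  · exact (hf.filter_mono nhdsWithin_le_nhds).mono fun x hx => hx.sub_const _
  · refine Eventually.of_forall fun x => ?_
    simpa using ((hasDerivAt_id' x).sub_const a).fun_pow 2
  · filter_upwards [self_mem_nhdsWithin] with x hx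
    exact mul_ne_zero two_ne_zero (sub_ne_zero.2 hx)
  · have := hf.self_of_nhds.continuousAt.tendsto.sub_const (f a)
    simpa using this.mono_left nhdsWithin_le_nhds
  · have : Tendsto (fun x => (x - a) ^ 2) (𝓝 a) (𝓝 ((a - a) ^ 2)) :=
      Continuous.tendsto (by fun_prop) a
    simpa using this.mono_left nhdsWithin_le_nhds
  · have := (hasDerivAt_iff_tendsto_slope.1 hf').div_const 2
    refine this.congr fun x => ?_
    simp only [slope_def_field, hf'a, sub_zero]
    rw [div_div, mul_comm]

/-- If `f` is continuous on a compact set with strict maximum at `a`, and its second-order quotient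
at `a` has a negative limit, then `f` lies below a downward parabola with vertex at `a`. -/
theorem exists_quadratic_upper_bound {f : ℝ → ℝ} {s : Set ℝ} {a d : ℝ} (hs : IsCompact s)
    (hfs : ContinuousOn f s) (ha : a ∈ s) (hmax : ∀ u ∈ s, u ≠ a → f u < f a) (hd : d < 0)
    (hlim : Tendsto (fun x => (f x - f a) / (x - a) ^ 2) (𝓝[≠] a) (𝓝 d)) :
    ∃ c > 0, ∀ u ∈ s, f u - f a ≤ -c * (u - a) ^ 2 := by
  set q := Function.update (fun x => (f x - f a) / (x - a) ^ 2) a d with hq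
  have hqc : ContinuousOn q s := by
    rw [hq, continuousOn_update_iff]
    refine ⟨?_, fun _ => hlim.mono_left (nhdsWithin_mono _ fun x hx => hx.2)⟩
    refine ((hfs.mono Set.sdiff_subset).sub continuousOn_const).div (by fun_prop) fun x hx => ?_
    exact pow_ne_zero 2 (sub_ne_zero.2 hx.2)
  have hqneg : ∀ u ∈ s, q u < 0 := by
    intro u hu
    by_cases h : u = a
    · simpa [hq, h] using hd
    · simp only [hq, Function.update_of_ne h]
      exact div_neg_of_neg_of_pos (sub_neg.2 (hmax u hu h))
        (by have := sub_ne_zero.2 h; positivity)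
  obtain ⟨b, hb, hbmax⟩ := hs.exists_isMaxOn ⟨a, ha⟩ hqc
  refine ⟨-q b, neg_pos.2 (hqneg b hb), fun u hu => ?_⟩
  by_cases h : u = a
  · simp [h]
  · have h1 : q u ≤ q b := hbmax hu
    have h2 : 0 < (u - a) ^ 2 := by have := sub_ne_zero.2 h; positivity
    simp only [hq, Function.update_of_ne h] at h1
    rw [neg_neg]
    exact (div_le_iff₀ h2).1 h1

/-- Negative of the binary entropy. -/
noncomputable def negEntropy (u : ℝ) : ℝ := u * log u + (1 - u) * log (1 - u)

/-- The binomial coefficient divided by its exponential growth rate. -/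
noncomputable def chooseRatio (N k : ℕ) : ℝ :=
  (N.choose k : ℝ) * exp (N * negEntropy (k / N))

theorem chooseRatio_nonneg (N k : ℕ) : 0 ≤ chooseRatio N k := by
  unfold chooseRatio; positivity

theorem chooseRatio_le_one {N k : ℕ} (hk : k ≤ N) : chooseRatio N k ≤ 1 := by
  rcases Nat.eq_zero_or_pos k with rfl | hk0
  · simp [chooseRatio, negEntropy]
  rcases hk.eq_or_lt with rfl | hkN
  · have : (k : ℝ) ≠ 0 := by positivity
    simp [chooseRatio, negEntropy, this]
  have hk' : (0 : ℝ) < k := by exact_mod_cast hk0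
  have hkN' : (k : ℝ) < N := by exact_mod_cast hkN
  have hN : (0 : ℝ) < N := hk'.trans hkN'
  set p : ℝ := k / N with hp
  have hp0 : 0 < p := by positivity
  have hp1 : 0 < 1 - p := by rw [sub_pos, hp, div_lt_one hN]; exact hkN'
  have hexp : exp (N * negEntropy p) = p ^ k * (1 - p) ^ (N - k) := by
    have h1 : N * negEntropy p = k * log p + ((N - k : ℕ) : ℝ) * log (1 - p) := by
      rw [negEntropy, Nat.cast_sub hk, hp]
      field_simp
    rw [h1, exp_add, ← Real.log_pow, ← Real.log_pow, exp_log (by positivity),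
      exp_log (by positivity)]
  have hsum := add_pow p (1 - p) N
  rw [add_sub_cancel, one_pow] at hsum
  have hle := Finset.single_le_sum (f := fun m => p ^ m * (1 - p) ^ (N - m) * (N.choose m : ℝ))
    (fun i _ => by positivity) (Finset.mem_range.2 (Nat.lt_succ_of_le hk))
  rw [← hsum] at hle
  rw [chooseRatio, hexp, mul_comm]
  exact hle

theorem factorial_eq_stirlingSeq {n : ℕ} (hn : 0 < n) :
    (n.factorial : ℝ) = stirlingSeq n * √(2 * n) * exp (n * log n - n) := by
  have hn' : (0 : ℝ) < n := by exact_mod_cast hn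
  have h : exp (n * log n - n) = (n / exp 1) ^ n := by
    rw [exp_sub, ← Real.log_pow, exp_log (by positivity), div_pow, ← exp_nat_mul, mul_one]
  rw [h, stirlingSeq]
  field_simp

/-- Stirling's formula for binomial coefficients. -/
theorem chooseRatio_eq {N k : ℕ} (hk0 : 0 < k) (hkN : k < N) :
    chooseRatio N k = stirlingSeq N / (stirlingSeq k * stirlingSeq (N - k)) *
      ((√(2 * N))⁻¹ * (√((k / N : ℝ) * (1 - k / N)))⁻¹) := by
  obtain ⟨l, rfl⟩ := Nat.exists_eq_add_of_lt hkN
  set m := l + 1 with hm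
  have hm0 : 0 < m := by omega
  rw [show k + l + 1 = k + m by omega, Nat.add_sub_cancel_left]
  have hk' : (0 : ℝ) < k := by exact_mod_cast hk0
  have hm' : (0 : ℝ) < m := by exact_mod_cast hm0
  have hsk : 0 < stirlingSeq k := (sqrt_pos.2 pi_pos).trans_le (sqrt_pi_le_stirlingSeq hk0.ne')
  have hsm : 0 < stirlingSeq m := (sqrt_pos.2 pi_pos).trans_le (sqrt_pi_le_stirlingSeq hm0.ne')
  have hfac : ((k + m).choose k : ℝ) * k.factorial * m.factorial = (k + m).factorial := by
    have := Nat.choose_mul_factorial_mul_factorial (Nat.le_add_right k m)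
    rw [Nat.add_sub_cancel_left] at this
    exact_mod_cast this
  rw [factorial_eq_stirlingSeq hk0, factorial_eq_stirlingSeq hm0,
    factorial_eq_stirlingSeq (by omega : 0 < k + m)] at hfac
  push_cast at hfac ⊢
  have hent : exp (((k + m : ℕ) : ℝ) * negEntropy (k / (k + m : ℕ))) =
      exp (k * log k - k) * exp (m * log m - m) /
        exp ((k + m : ℝ) * log (k + m) - (k + m)) := by
    rw [← exp_add, ← exp_sub]
    congr 1
    have h1 : 1 - (k : ℝ) / (k + m) = m / (k + m) := by field_simp; ring
    push_cast
    rw [negEntropy, h1, log_div (by positivity) (by positivity),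
      log_div (by positivity) (by positivity)]
    field_simp
    ring
  have hprod : √((k : ℝ) / (k + m) * (1 - k / (k + m))) =
      √(2 * k) * √(2 * m) / (√(2 * (k + m)) * √(2 * (k + m))) := by
    rw [← sqrt_mul (by positivity), ← sqrt_mul (by positivity), ← sqrt_div (by positivity)]
    congr 1
    field_simp
    ring
  rw [chooseRatio, hent, hprod]
  have e1 := exp_pos (k * log k - k : ℝ)
  have e2 := exp_pos (m * log m - m : ℝ)
  have e3 := exp_pos ((k + m : ℝ) * log (k + m) - (k + m))
  have r1 : 0 < √(2 * (k : ℝ)) := by positivity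
  have r2 : 0 < √(2 * (m : ℝ)) := by positivity
  have r3 : 0 < √(2 * ((k : ℝ) + m)) := by positivity
  generalize exp (k * log k - k : ℝ) = E1 at *
  generalize exp (m * log m - m : ℝ) = E2 at *
  generalize exp ((k + m : ℝ) * log (k + m) - (k + m)) = E3 at *
  generalize √(2 * (k : ℝ)) = R1 at *
  generalize √(2 * (m : ℝ)) = R2 at *
  generalize √(2 * ((k : ℝ) + m)) = R3 at *
  field_simp
  linear_combination hfac

/-- A step function on a grid of mesh `δ`, evaluated through the floor function. -/
theorem sum_indicator_Ico_grid {a δ : ℝ} (hδ : 0 < δ) (N : ℕ) (c : ℕ → ℝ) (x : ℝ) :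
    ∑ k ∈ Finset.range (N + 1),
        (Set.Ico (a + k * δ) (a + k * δ + δ)).indicator (fun _ => c k) x =
      if a ≤ x ∧ ⌊(x - a) / δ⌋₊ ≤ N then c ⌊(x - a) / δ⌋₊ else 0 := by
  have key : ∀ k : ℕ, x ∈ Set.Ico (a + k * δ) (a + k * δ + δ) ↔
      a ≤ x ∧ ⌊(x - a) / δ⌋₊ = k := by
    intro k
    constructor
    · rintro ⟨h1, h2⟩
      have hx : a ≤ x := le_trans (le_add_of_nonneg_right (by positivity)) h1
      refine ⟨hx, (Nat.floor_eq_iff (div_nonneg (sub_nonneg.2 hx) hδ.le)).2 ⟨?_, ?_⟩⟩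
      · rw [le_div_iff₀ hδ]; linarith
      · rw [div_lt_iff₀ hδ]; linarith
    · rintro ⟨hx, hk⟩
      obtain ⟨h1, h2⟩ := (Nat.floor_eq_iff (div_nonneg (sub_nonneg.2 hx) hδ.le)).1 hk
      rw [le_div_iff₀ hδ] at h1
      rw [div_lt_iff₀ hδ] at h2
      exact ⟨by linarith, by linarith⟩
  simp only [Set.indicator_apply, key]
  by_cases hx : a ≤ x
  · simp [hx]
  · simp [hx]

/-- Riemann-type sums over expanding grids of vanishing mesh converge to the integral of the local
limit, under an integrable domination. -/
theorem tendsto_grid_sum_of_local_limit {N : ℕ → ℕ} {a δ : ℕ → ℝ} {c : ℕ → ℕ → ℝ}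
    {F B : ℝ → ℝ} (hδ : ∀ᶠ n in atTop, 0 < δ n) (hδ0 : Tendsto δ atTop (𝓝 0))
    (ha : Tendsto a atTop atBot) (hb : Tendsto (fun n => a n + N n * δ n) atTop atTop)
    (hB : Integrable B) (hB0 : ∀ x, 0 ≤ B x)
    (hbound : ∀ᶠ n in atTop, ∀ k ≤ N n, ∀ x, |x - (a n + k * δ n)| ≤ δ n → |c n k| ≤ B x)
    (hlim : ∀ (x : ℝ) (k : ℕ → ℕ), Tendsto (fun n => a n + k n * δ n) atTop (𝓝 x) →
      Tendsto (fun n => c n (k n)) atTop (𝓝 (F x))) :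
    Tendsto (fun n => δ n * ∑ k ∈ Finset.range (N n + 1), c n k) atTop (𝓝 (∫ x, F x)) := by
  set G : ℕ → ℝ → ℝ := fun n x => ∑ k ∈ Finset.range (N n + 1),
    (Set.Ico (a n + k * δ n) (a n + k * δ n + δ n)).indicator (fun _ => c n k) x with hG
  have hint : ∀ᶠ n in atTop, ∫ x, G n x = δ n * ∑ k ∈ Finset.range (N n + 1), c n k := by
    filter_upwards [hδ] with n hn
    rw [hG]
    simp only
    rw [integral_finsetSum, Finset.mul_sum]
    · refine Finset.sum_congr rfl fun k _ => ?_
      rw [integral_indicator_const _ measurableSet_Ico, Real.volume_real_Ico_of_le (by linarith)]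
      simp
    · intro k _
      exact (integrable_indicator_iff measurableSet_Ico).2 (integrableOn_const (by simp))
  refine Tendsto.congr' hint ?_
  refine tendsto_integral_filter_of_dominated_convergence B ?_ ?_ hB ?_
  · refine Eventually.of_forall fun n => Measurable.aestronglyMeasurable ?_
    exact Finset.measurable_fun_sum _ fun k _ => measurable_const.indicator measurableSet_Ico
  · filter_upwards [hδ, hbound] with n hn hbn
    refine Eventually.of_forall fun x => ?_
    rw [hG]
    simp only
    rw [sum_indicator_Ico_grid hn, Real.norm_eq_abs]
    split_ifs with h
    · refine hbn _ h.2 x ?_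
      have h1 := Nat.floor_le (div_nonneg (sub_nonneg.2 h.1) hn.le)
      have h2 := Nat.lt_floor_add_one ((x - a n) / δ n)
      rw [le_div_iff₀ hn] at h1
      rw [div_lt_iff₀ hn] at h2
      rw [abs_le]
      constructor <;> linarith
    · simpa using hB0 x
  · refine Eventually.of_forall fun x => ?_
    have hgood : ∀ᶠ n in atTop, 0 < δ n ∧ a n ≤ x ∧ ⌊(x - a n) / δ n⌋₊ ≤ N n := by
      filter_upwards [hδ, ha.eventually_le_atBot x, hb.eventually_ge_atTop x] with n h1 h2 h3
      refine ⟨h1, h2, ?_⟩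
      rw [← Nat.floor_natCast (R := ℝ) (N n)]
      apply Nat.floor_le_floor
      rw [div_le_iff₀ h1]
      linarith
    refine Tendsto.congr' ?_ (hlim x (fun n => ⌊(x - a n) / δ n⌋₊) ?_)
    · filter_upwards [hgood] with n hn
      rw [hG]
      simp only
      rw [sum_indicator_Ico_grid hn.1, if_pos hn.2]
    · have hlow : Tendsto (fun n => x - δ n) atTop (𝓝 x) := by
        simpa using hδ0.const_sub x
      refine tendsto_of_tendsto_of_tendsto_of_le_of_le' hlow tendsto_const_nhds ?_ ?_
      · filter_upwards [hgood] with n hn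
        have h2 := Nat.lt_floor_add_one ((x - a n) / δ n)
        rw [div_lt_iff₀ hn.1] at h2
        linarith
      · filter_upwards [hgood] with n hn
        have h1 := Nat.floor_le (div_nonneg (sub_nonneg.2 hn.2.1) hn.1.le)
        rw [le_div_iff₀ hn.1] at h1
        linarith

/-- The number of vertex pairs. -/
def edgeCount (n : ℕ) : ℕ := n * (n - 1) / 2

theorem cast_edgeCount (n : ℕ) : (edgeCount n : ℝ) = n * (n - 1) / 2 := by
  rw [edgeCount, ← Nat.choose_two_right, Nat.cast_choose_two]

/-- Coefficient of the order-`n` correction to the exponent `n² g`. -/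
noncomputable def tilt (α : ℝ) (n : ℕ) : ℝ := α / 6 * (n - 1) * (2 - 1 / n)

/-- Rescaled deviation from `u₀` of the fraction of pairs that are edges. -/
noncomputable def fluct (u₀ : ℝ) (n k : ℕ) : ℝ := n * (k / edgeCount n - u₀)

/-- The mean-field weight normalized by its exponential order at `u₀`. -/
noncomputable def rescaledWeight (α h u₀ : ℝ) (n k : ℕ) : ℝ :=
  n * chooseRatio (edgeCount n) k *
    exp (2 * edgeCount n * (gFun α h (k / edgeCount n) - gFun α h u₀) -
      tilt α n * ((k / edgeCount n : ℝ) ^ 3 - u₀ ^ 3))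

theorem rescaledWeight_nonneg (α h u₀ : ℝ) (n k : ℕ) : 0 ≤ rescaledWeight α h u₀ n k := by
  have := chooseRatio_nonneg (edgeCount n) k
  unfold rescaledWeight
  positivity

theorem mfDensity_eq {n : ℕ} (hn : 2 ≤ n) (k : ℕ) :
    mfDensity n k = k / edgeCount n * (1 - 1 / n) := by
  have h2 : (2 : ℝ) ≤ n := by exact_mod_cast hn
  have h1 : (n : ℝ) - 1 ≠ 0 := by linarith
  have h0 : (n : ℝ) ≠ 0 := by linarith
  rw [mfDensity, cast_edgeCount]
  field_simp

theorem mfWeight_eq (α h u₀ : ℝ) {n : ℕ} (hn : 2 ≤ n) (k : ℕ) :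
    mfWeight α h n k =
      exp (2 * edgeCount n * gFun α h u₀ - tilt α n * u₀ ^ 3) / n *
        rescaledWeight α h u₀ n k := by
  have h2 : (2 : ℝ) ≤ n := by exact_mod_cast hn
  have h0 : (n : ℝ) ≠ 0 := by linarith
  rw [mfWeight, mfDensity_eq hn, rescaledWeight, chooseRatio]
  change ((edgeCount n).choose k : ℝ) * _ = _
  set p : ℝ := k / edgeCount n
  have hexp : exp ((n : ℝ) ^ 2 * (α / 6 * (p * (1 - 1 / n)) ^ 3 + h / 2 * (p * (1 - 1 / n)))) =
      exp (2 * edgeCount n * gFun α h u₀ - tilt α n * u₀ ^ 3) *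
      exp (edgeCount n * negEntropy p) *
      exp (2 * edgeCount n * (gFun α h p - gFun α h u₀) - tilt α n * (p ^ 3 - u₀ ^ 3)) := by
    rw [← exp_add, ← exp_add]
    congr 1
    have : gFun α h p = α / 6 * p ^ 3 + h / 2 * p - negEntropy p / 2 := rfl
    rw [this, tilt, cast_edgeCount]
    field_simp
    ring
  rw [hexp]
  field_simp

theorem mfExp_eq (α h u₀ : ℝ) {n : ℕ} (hn : 2 ≤ n) (f : ℝ → ℝ) :
    mfExp α h n f =
      (∑ k ∈ Finset.range (edgeCount n + 1), f (mfDensity n k) * rescaledWeight α h u₀ n k) /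
        ∑ k ∈ Finset.range (edgeCount n + 1), rescaledWeight α h u₀ n k := by
  have h2 : (2 : ℝ) ≤ n := by exact_mod_cast hn
  have h0 : (n : ℝ) ≠ 0 := by linarith
  rw [mfExp, mfZ]
  change (∑ k ∈ Finset.range (edgeCount n + 1), _) / ∑ k ∈ Finset.range (edgeCount n + 1), _ = _
  simp only [mfWeight_eq α h u₀ hn, mul_left_comm (f _)]
  rw [← Finset.mul_sum, ← Finset.mul_sum]
  exact mul_div_mul_left _ _ (by positivity)

theorem tendsto_edgeCount : Tendsto (fun n => (edgeCount n : ℝ)) atTop atTop := by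
  refine tendsto_atTop_mono' _ ?_ tendsto_natCast_atTop_atTop
  filter_upwards [eventually_ge_atTop 3] with n hn
  have h3 : (3 : ℝ) ≤ n := by exact_mod_cast hn
  rw [cast_edgeCount]
  nlinarith

theorem tendsto_one_sub_one_div_natCast :
    Tendsto (fun n : ℕ => 1 - 1 / (n : ℝ)) atTop (𝓝 1) := by
  simpa using (tendsto_one_div_atTop_nhds_zero_nat (𝕜 := ℝ)).const_sub 1

theorem two_mul_edgeCount_eq {n : ℕ} (hn : n ≠ 0) :
    2 * (edgeCount n : ℝ) = n ^ 2 * (1 - 1 / n) := by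
  have : (n : ℝ) ≠ 0 := by exact_mod_cast hn
  rw [cast_edgeCount]
  field_simp

theorem tendsto_mul_chooseRatio {u₀ : ℝ} (hu₀ : u₀ ∈ Set.Ioo (0 : ℝ) 1) {k : ℕ → ℕ}
    (hk : Tendsto (fun n => (k n : ℝ) / edgeCount n) atTop (𝓝 u₀)) :
    Tendsto (fun n => n * chooseRatio (edgeCount n) (k n)) atTop
      (𝓝 ((√π)⁻¹ * (√(u₀ * (1 - u₀)))⁻¹)) := by
  have hN := tendsto_edgeCount
  have hgood : ∀ᶠ n in atTop, 0 < k n ∧ k n < edgeCount n := by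
    filter_upwards [hk.eventually_const_lt hu₀.1, hk.eventually_lt_const hu₀.2,
      hN.eventually_gt_atTop 0] with n h1 h2 h3
    constructor
    · rw [lt_div_iff₀ h3, zero_mul] at h1
      exact_mod_cast h1
    · rw [div_lt_one h3] at h2
      exact_mod_cast h2
  have hkinf : Tendsto k atTop atTop := by
    rw [← tendsto_natCast_atTop_iff (R := ℝ)]
    refine (hk.pos_mul_atTop hu₀.1 hN).congr' ?_
    filter_upwards [hN.eventually_gt_atTop 0] with n h3
    exact div_mul_cancel₀ _ h3.ne'
  have hlinf : Tendsto (fun n => edgeCount n - k n) atTop atTop := by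
    rw [← tendsto_natCast_atTop_iff (R := ℝ)]
    refine ((hk.const_sub 1).pos_mul_atTop (sub_pos.2 hu₀.2) hN).congr' ?_
    filter_upwards [hN.eventually_gt_atTop 0, hgood] with n h3 h4
    rw [Nat.cast_sub h4.2.le]
    field_simp
  have hNinf : Tendsto edgeCount atTop atTop := (tendsto_natCast_atTop_iff (R := ℝ)).1 hN
  have hπ : 0 < √π := sqrt_pos.2 pi_pos
  have hs : Tendsto (fun n => stirlingSeq (edgeCount n) /
      (stirlingSeq (k n) * stirlingSeq (edgeCount n - k n))) atTop (𝓝 (√π / (√π * √π))) :=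
    (tendsto_stirlingSeq_sqrt_pi.comp hNinf).div
      ((tendsto_stirlingSeq_sqrt_pi.comp hkinf).mul (tendsto_stirlingSeq_sqrt_pi.comp hlinf))
      (by positivity)
  have hn1 : Tendsto (fun n : ℕ => (n : ℝ) * (√(2 * edgeCount n))⁻¹) atTop (𝓝 1) := by
    have : Tendsto (fun n : ℕ => (√(1 - 1 / (n : ℝ)))⁻¹) atTop (𝓝 1) := by
      simpa using (tendsto_one_sub_one_div_natCast.sqrt).inv₀ (by simp)
    refine this.congr' ?_
    filter_upwards [eventually_ne_atTop 0] with n hn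
    have hn' : (n : ℝ) ≠ 0 := by exact_mod_cast hn
    rw [two_mul_edgeCount_eq hn, sqrt_mul (by positivity), sqrt_sq (by positivity), mul_inv,
      mul_inv_cancel_left₀ hn']
  have hv : 0 < u₀ * (1 - u₀) := mul_pos hu₀.1 (sub_pos.2 hu₀.2)
  have hp : Tendsto (fun n => (√((k n / edgeCount n : ℝ) * (1 - k n / edgeCount n)))⁻¹) atTop
      (𝓝 ((√(u₀ * (1 - u₀)))⁻¹)) :=
    ((hk.mul (hk.const_sub 1)).sqrt).inv₀ (sqrt_pos.2 hv).ne'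
  have := (hs.mul hn1).mul hp
  have hval : √π / (√π * √π) * 1 * (√(u₀ * (1 - u₀)))⁻¹ = (√π)⁻¹ * (√(u₀ * (1 - u₀)))⁻¹ := by
    field_simp
  rw [hval] at this
  refine this.congr' ?_
  filter_upwards [hgood] with n hn
  rw [chooseRatio_eq hn.1 hn.2]
  ring

theorem sq_div_two_le_two_mul_edgeCount {n : ℕ} (hn : 2 ≤ n) :
    (n : ℝ) ^ 2 / 2 ≤ 2 * edgeCount n := by
  have h2 : (2 : ℝ) ≤ n := by exact_mod_cast hn
  rw [cast_edgeCount]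
  nlinarith

theorem div_edgeCount_mem_Icc {n k : ℕ} (hk : k ≤ edgeCount n) :
    (k / edgeCount n : ℝ) ∈ Set.Icc (0 : ℝ) 1 :=
  ⟨by positivity, div_le_one_of_le₀ (by exact_mod_cast hk) (by positivity)⟩

theorem exists_mul_chooseRatio_le {u₀ : ℝ} (hu₀ : u₀ ∈ Set.Ioo (0 : ℝ) 1) :
    ∃ C > 0, ∀ n ≥ 2, ∀ k ≤ edgeCount n,
      n * chooseRatio (edgeCount n) k ≤ C * (1 + |fluct u₀ n k|) := by
  obtain ⟨S, hS⟩ := tendsto_stirlingSeq_sqrt_pi.bddAbove_range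
  have hS' : ∀ n, stirlingSeq n ≤ S := fun n => hS ⟨n, rfl⟩
  have hπ : 0 < √π := sqrt_pos.2 pi_pos
  have hS0 : 0 < S := hπ.trans_le ((sqrt_pi_le_stirlingSeq one_ne_zero).trans (hS' 1))
  obtain ⟨ε, hε, hε1, hε2⟩ : ∃ ε > 0, 2 * ε ≤ u₀ ∧ 2 * ε ≤ 1 - u₀ := by
    refine ⟨min u₀ (1 - u₀) / 2, ?_, ?_, ?_⟩
    · have := lt_min hu₀.1 (sub_pos.2 hu₀.2)
      positivity
    · linarith [min_le_left u₀ (1 - u₀)]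
    · linarith [min_le_right u₀ (1 - u₀)]
  refine ⟨S / (√π * √π) * (2 * ε⁻¹) + ε⁻¹, by positivity, fun n hn k hk => ?_⟩
  have hn' : (2 : ℝ) ≤ n := by exact_mod_cast hn
  have hN := sq_div_two_le_two_mul_edgeCount hn
  have hN0 : (0 : ℝ) < edgeCount n := by nlinarith
  set y := fluct u₀ n k with hy
  rw [fluct] at hy
  set p : ℝ := k / edgeCount n with hp
  have hA : 0 < S / (√π * √π) * (2 * ε⁻¹) := by positivity
  have hεi : 0 < ε⁻¹ := by positivity
  have hy0 := abs_nonneg y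
  by_cases hclose : |p - u₀| < ε
  · rw [abs_lt] at hclose
    have hpε : ε ≤ p := by linarith [hclose.1]
    have hpε' : ε ≤ 1 - p := by linarith [hclose.2]
    have hk0 : 0 < k := by
      rcases Nat.eq_zero_or_pos k with rfl | h
      · simp [hp] at hpε; linarith
      · exact h
    have hkN : k < edgeCount n := by
      have : p < 1 := by linarith
      rw [hp, div_lt_one hN0] at this
      exact_mod_cast this
    have h1 : stirlingSeq (edgeCount n) / (stirlingSeq k * stirlingSeq (edgeCount n - k)) ≤
        S / (√π * √π) := by
      have hsk := sqrt_pi_le_stirlingSeq hk0.ne'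
      have := hπ.le.trans hsk
      have := sqrt_pi_le_stirlingSeq (Nat.sub_pos_of_lt hkN).ne'
      have := hS' (edgeCount n)
      gcongr
    have h2 : (n : ℝ) * (√(2 * edgeCount n))⁻¹ ≤ 2 := by
      have : (n : ℝ) / 2 ≤ √(2 * edgeCount n) := le_sqrt_of_sq_le (by nlinarith)
      rw [← div_eq_mul_inv, div_le_iff₀ (by linarith)]
      linarith
    have h3 : (√(p * (1 - p)))⁻¹ ≤ ε⁻¹ := by
      have : ε ≤ √(p * (1 - p)) := le_sqrt_of_sq_le (by nlinarith)
      gcongr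
    rw [chooseRatio_eq hk0 hkN]
    calc (n : ℝ) * (stirlingSeq (edgeCount n) /
          (stirlingSeq k * stirlingSeq (edgeCount n - k)) *
          ((√(2 * edgeCount n))⁻¹ * (√(p * (1 - p)))⁻¹))
        = stirlingSeq (edgeCount n) / (stirlingSeq k * stirlingSeq (edgeCount n - k)) *
          ((n * (√(2 * edgeCount n))⁻¹) * (√(p * (1 - p)))⁻¹) := by ring
      _ ≤ S / (√π * √π) * (2 * ε⁻¹) := by gcongr
      _ ≤ _ := by nlinarith
  · rw [not_lt] at hclose
    have h1 : (n : ℝ) ≤ ε⁻¹ * |y| := by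
      rw [inv_mul_eq_div, le_div_iff₀ hε, hy, abs_mul, Nat.abs_cast]
      gcongr
    have h2 : (n : ℝ) * chooseRatio (edgeCount n) k ≤ n * 1 := by
      gcongr
      exact chooseRatio_le_one hk
    nlinarith

theorem abs_cube_sub_cube_le {p u : ℝ} (hp : p ∈ Set.Icc (0 : ℝ) 1) (hu : u ∈ Set.Icc (0 : ℝ) 1) :
    |p ^ 3 - u ^ 3| ≤ 3 * |p - u| := by
  have h : p ^ 3 - u ^ 3 = (p ^ 2 + p * u + u ^ 2) * (p - u) := by ring
  obtain ⟨hp0, hp1⟩ := hp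
  obtain ⟨hu0, hu1⟩ := hu
  rw [h, abs_mul, abs_of_nonneg (by positivity)]
  gcongr
  nlinarith

theorem abs_tilt_le (α : ℝ) {n : ℕ} (hn : 2 ≤ n) : |tilt α n| ≤ |α| / 3 * n := by
  have hn' : (2 : ℝ) ≤ n := by exact_mod_cast hn
  have h1 : 1 / (n : ℝ) ≤ 1 / 2 := by gcongr
  have h2 : 0 < 1 / (n : ℝ) := by positivity
  rw [tilt, abs_mul, abs_mul, abs_div, abs_of_nonneg (by linarith : (0 : ℝ) ≤ n - 1),
    abs_of_nonneg (by linarith : (0 : ℝ) ≤ 2 - 1 / n), abs_of_pos (by norm_num : (0 : ℝ) < 6)]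
  have h3 : ((n : ℝ) - 1) * (2 - 1 / n) ≤ n * 2 := by
    apply mul_le_mul <;> linarith
  have := mul_le_mul_of_nonneg_left h3 (by positivity : 0 ≤ |α| / 6)
  linarith

theorem exists_rescaledWeight_le {α h u₀ : ℝ} (hu₀ : u₀ ∈ Set.Ioo (0 : ℝ) 1)
    (hquad : ∃ c > 0, ∀ u ∈ Set.Icc (0 : ℝ) 1,
      gFun α h u - gFun α h u₀ ≤ -c * (u - u₀) ^ 2) :
    ∃ C > 0, ∃ c > 0, ∀ n ≥ 2, ∀ k ≤ edgeCount n, rescaledWeight α h u₀ n k ≤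
      C * (1 + |fluct u₀ n k|) * exp (-c * fluct u₀ n k ^ 2 + |α| * |fluct u₀ n k|) := by
  obtain ⟨C, hC, hCb⟩ := exists_mul_chooseRatio_le hu₀
  obtain ⟨c, hc, hcb⟩ := hquad
  refine ⟨C, hC, c / 2, by positivity, fun n hn k hk => ?_⟩
  have hp := div_edgeCount_mem_Icc hk
  have hN := sq_div_two_le_two_mul_edgeCount hn
  have h1 := hcb _ hp
  have h2 := abs_cube_sub_cube_le hp ⟨hu₀.1.le, hu₀.2.le⟩
  have hpn := chooseRatio_nonneg (edgeCount n) k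
  rw [rescaledWeight]
  refine mul_le_mul (hCb n hn k hk) (exp_le_exp.2 ?_) (exp_pos _).le (by positivity)
  rw [fluct]
  set p : ℝ := k / edgeCount n
  have h3 : 2 * (edgeCount n : ℝ) * (gFun α h p - gFun α h u₀) ≤
      -(c / 2) * (n * (p - u₀)) ^ 2 := by
    calc 2 * (edgeCount n : ℝ) * (gFun α h p - gFun α h u₀)
        ≤ 2 * (edgeCount n : ℝ) * (-c * (p - u₀) ^ 2) := by gcongr
      _ = -((2 * edgeCount n) * (c * (p - u₀) ^ 2)) := by ring
      _ ≤ -((n : ℝ) ^ 2 / 2 * (c * (p - u₀) ^ 2)) := by gcongr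
      _ = _ := by ring
  have h4 : -(tilt α n * (p ^ 3 - u₀ ^ 3)) ≤ |α| * |n * (p - u₀)| := by
    calc -(tilt α n * (p ^ 3 - u₀ ^ 3)) ≤ |tilt α n * (p ^ 3 - u₀ ^ 3)| := neg_le_abs _
      _ = |tilt α n| * |p ^ 3 - u₀ ^ 3| := abs_mul _ _
      _ ≤ (|α| / 3 * n) * (3 * |p - u₀|) := by
          gcongr
          exact abs_tilt_le α hn
      _ = _ := by rw [abs_mul, Nat.abs_cast]; ring
  linarith

theorem tendsto_div_edgeCount {u₀ x : ℝ} {k : ℕ → ℕ}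
    (hk : Tendsto (fun n => fluct u₀ n (k n)) atTop (𝓝 x)) :
    Tendsto (fun n => (k n : ℝ) / edgeCount n) atTop (𝓝 u₀) := by
  have h1 : Tendsto (fun n => fluct u₀ n (k n) * (1 / (n : ℝ)) + u₀) atTop (𝓝 u₀) := by
    simpa using (hk.mul (tendsto_one_div_atTop_nhds_zero_nat (𝕜 := ℝ))).add_const u₀
  refine h1.congr' ?_
  filter_upwards [eventually_ne_atTop 0] with n hn
  have hn' : (n : ℝ) ≠ 0 := by exact_mod_cast hn
  rw [fluct]
  field_simp
  ring

theorem tendsto_rescaledWeight {α h u₀ c₀ : ℝ} (hu₀ : u₀ ∈ Set.Ioo (0 : ℝ) 1)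
    (hlim : Tendsto (fun u => (gFun α h u - gFun α h u₀) / (u - u₀) ^ 2) (𝓝[≠] u₀) (𝓝 (-c₀)))
    {x : ℝ} {k : ℕ → ℕ} (hk : Tendsto (fun n => fluct u₀ n (k n)) atTop (𝓝 x)) :
    Tendsto (fun n => rescaledWeight α h u₀ n (k n)) atTop
      (𝓝 ((√π)⁻¹ * (√(u₀ * (1 - u₀)))⁻¹ * exp (-c₀ * x ^ 2 - α * u₀ ^ 2 * x))) := by
  have hp := tendsto_div_edgeCount hk
  set q := Function.update (fun u => (gFun α h u - gFun α h u₀) / (u - u₀) ^ 2) u₀ (-c₀) with hq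
  have hqc : ContinuousAt q u₀ := continuousAt_update_same.2 hlim
  have hqp : Tendsto (fun n => q ((k n : ℝ) / edgeCount n)) atTop (𝓝 (-c₀)) := by
    have hq₀ : q u₀ = -c₀ := Function.update_self ..
    exact hq₀ ▸ hqc.tendsto.comp hp
  have hqg : ∀ u, gFun α h u - gFun α h u₀ = q u * (u - u₀) ^ 2 := by
    intro u
    by_cases hu : u = u₀
    · simp [hu]
    · have := sub_ne_zero.2 hu
      simp only [hq, Function.update_of_ne hu]
      field_simp
  refine (tendsto_mul_chooseRatio hu₀ hp).mul ((continuous_exp.tendsto _).comp ?_)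
  have hmain : Tendsto (fun n : ℕ => (1 - 1 / (n : ℝ)) * q ((k n : ℝ) / edgeCount n) *
        fluct u₀ n (k n) ^ 2 -
      α / 6 * (1 - 1 / (n : ℝ)) * (2 - 1 / n) * fluct u₀ n (k n) *
        (((k n : ℝ) / edgeCount n) ^ 2 + (k n : ℝ) / edgeCount n * u₀ + u₀ ^ 2)) atTop
      (𝓝 (1 * -c₀ * x ^ 2 - α / 6 * 1 * (2 - 0) * x * (u₀ ^ 2 + u₀ * u₀ + u₀ ^ 2))) :=
    ((tendsto_one_sub_one_div_natCast.mul hqp).mul (hk.pow 2)).sub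
      ((((tendsto_one_sub_one_div_natCast.const_mul (α / 6)).mul
        ((tendsto_one_div_atTop_nhds_zero_nat (𝕜 := ℝ)).const_sub 2)).mul hk).mul
        (((hp.pow 2).add (hp.mul_const u₀)).add_const _))
  have hval : 1 * -c₀ * x ^ 2 - α / 6 * 1 * (2 - 0) * x * (u₀ ^ 2 + u₀ * u₀ + u₀ ^ 2) =
      -c₀ * x ^ 2 - α * u₀ ^ 2 * x := by ring
  rw [hval] at hmain
  refine hmain.congr' ?_
  filter_upwards [eventually_ne_atTop 0] with n hn
  have hn' : (n : ℝ) ≠ 0 := by exact_mod_cast hn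
  rw [hqg, two_mul_edgeCount_eq hn, tilt, fluct]
  generalize (k n : ℝ) / edgeCount n = p
  field_simp
  ring

/-- A Gaussian factor absorbs linear exponentials and bounded shifts of its argument. -/
theorem mul_exp_neg_sq_le_of_abs_sub_le_two {c : ℝ} (hc : 0 < c) (b : ℝ) {x y : ℝ}
    (hxy : |x - y| ≤ 2) :
    (1 + |y|) ^ 2 * exp (-c * y ^ 2 + b * |y|) ≤
      exp (2 * c + (b + 2) ^ 2 / (2 * c)) * exp (-(c / 4) * x ^ 2) := by
  have h1 : (1 + |y|) ^ 2 ≤ exp (2 * |y|) := by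
    have h := add_one_le_exp |y|
    have h0 := abs_nonneg y
    calc (1 + |y|) ^ 2 ≤ exp |y| ^ 2 := by gcongr; linarith
      _ = exp (2 * |y|) := by rw [← exp_nat_mul]; norm_num
  have h2 : (b + 2) * |y| ≤ c / 2 * y ^ 2 + (b + 2) ^ 2 / (2 * c) := by
    have h3 : c / 2 * y ^ 2 + (b + 2) ^ 2 / (2 * c) - (b + 2) * |y| =
        (c * |y| - (b + 2)) ^ 2 / (2 * c) := by
      rw [← sq_abs y]
      field_simp
      ring
    have : 0 ≤ (c * |y| - (b + 2)) ^ 2 / (2 * c) := by positivity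
    linarith
  have h3 : x ^ 2 ≤ 2 * y ^ 2 + 8 := by
    have : (x - y) ^ 2 ≤ 2 ^ 2 := sq_le_sq' (abs_le.1 hxy).1 (abs_le.1 hxy).2
    nlinarith [sq_nonneg (x - 2 * y)]
  calc (1 + |y|) ^ 2 * exp (-c * y ^ 2 + b * |y|)
      ≤ exp (2 * |y|) * exp (-c * y ^ 2 + b * |y|) := by gcongr
    _ = exp (2 * |y| + (-c * y ^ 2 + b * |y|)) := (exp_add _ _).symm
    _ ≤ exp (2 * c + (b + 2) ^ 2 / (2 * c) + -(c / 4) * x ^ 2) := by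
        rw [exp_le_exp]
        nlinarith
    _ = _ := exp_add _ _

/-- Sums of functions of linear growth against the rescaled weights converge to Gaussian
integrals. -/
theorem tendsto_sum_rescaledWeight {α h u₀ c₀ : ℝ} (hu₀ : u₀ ∈ Set.Ioo (0 : ℝ) 1)
    (hquad : ∃ c > 0, ∀ u ∈ Set.Icc (0 : ℝ) 1,
      gFun α h u - gFun α h u₀ ≤ -c * (u - u₀) ^ 2)
    (hlim : Tendsto (fun u => (gFun α h u - gFun α h u₀) / (u - u₀) ^ 2) (𝓝[≠] u₀) (𝓝 (-c₀)))
    {f : ℕ → ℕ → ℝ} {F : ℝ → ℝ} {K : ℝ}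
    (hfK : ∀ᶠ n in atTop, ∀ k ≤ edgeCount n, |f n k| ≤ K * (1 + |fluct u₀ n k|))
    (hfF : ∀ (x : ℝ) (k : ℕ → ℕ), Tendsto (fun n => fluct u₀ n (k n)) atTop (𝓝 x) →
      Tendsto (fun n => f n (k n)) atTop (𝓝 (F x))) :
    Tendsto (fun n => (n / edgeCount n : ℝ) *
        ∑ k ∈ Finset.range (edgeCount n + 1), f n k * rescaledWeight α h u₀ n k) atTop
      (𝓝 (∫ x, F x *
        ((√π)⁻¹ * (√(u₀ * (1 - u₀)))⁻¹ * exp (-c₀ * x ^ 2 - α * u₀ ^ 2 * x)))) := by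
  obtain ⟨C, hC, c, hc, hW⟩ := exists_rescaledWeight_le hu₀ hquad
  have hgrid : ∀ n k : ℕ, -(n * u₀) + k * (n / edgeCount n : ℝ) = fluct u₀ n k := fun n k => by
    rw [fluct]; ring
  have hmesh : ∀ n ≥ 2, 0 < (n / edgeCount n : ℝ) ∧ (n / edgeCount n : ℝ) ≤ 4 / n := by
    intro n hn
    have hn' : (2 : ℝ) ≤ n := by exact_mod_cast hn
    have hN := sq_div_two_le_two_mul_edgeCount hn
    have hN0 : (0 : ℝ) < edgeCount n := by nlinarith
    refine ⟨by positivity, ?_⟩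
    rw [div_le_div_iff₀ hN0 (by linarith)]
    nlinarith
  have hcast : Tendsto (fun n : ℕ => (n : ℝ)) atTop atTop := tendsto_natCast_atTop_atTop
  refine tendsto_grid_sum_of_local_limit (N := edgeCount) (a := fun n => -(n * u₀))
    (δ := fun n => (n / edgeCount n : ℝ)) (c := fun n k => f n k * rescaledWeight α h u₀ n k)
    (B := fun x => |K| * C * (exp (2 * c + (|α| + 2) ^ 2 / (2 * c)) * exp (-(c / 4) * x ^ 2)))
    ?_ ?_ ?_ ?_ ?_ ?_ ?_ ?_
  · filter_upwards [eventually_ge_atTop 2] with n hn using (hmesh n hn).1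
  · refine squeeze_zero' ?_ ?_ (tendsto_const_div_atTop_nhds_zero_nat (4 : ℝ))
    · exact Eventually.of_forall fun n => by positivity
    · filter_upwards [eventually_ge_atTop 2] with n hn using (hmesh n hn).2
  · exact tendsto_neg_atTop_atBot.comp (hcast.atTop_mul_const hu₀.1)
  · refine (hcast.atTop_mul_const (sub_pos.2 hu₀.2)).congr' ?_
    filter_upwards [tendsto_edgeCount.eventually_gt_atTop 0] with n hn
    field_simp
    ring
  · exact ((integrable_exp_neg_mul_sq (by positivity : 0 < c / 4)).const_mul _).const_mul _
  · intro x
    positivity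
  · filter_upwards [hfK, eventually_ge_atTop 2] with n hn hn2 k hk x hx
    simp only [hgrid] at hx
    have h2 : |x - fluct u₀ n k| ≤ 2 := by
      have hn' : (2 : ℝ) ≤ n := by exact_mod_cast hn2
      refine hx.trans ((hmesh n hn2).2.trans ?_)
      rw [div_le_iff₀ (by linarith)]
      linarith
    have hE := mul_exp_neg_sq_le_of_abs_sub_le_two hc |α| h2
    have h3 := hW n hn2 k hk
    have h4 : |f n k| ≤ |K| * (1 + |fluct u₀ n k|) :=
      (hn k hk).trans (by gcongr; exact le_abs_self K)
    rw [abs_mul, abs_of_nonneg (rescaledWeight_nonneg α h u₀ n k)]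
    calc |f n k| * rescaledWeight α h u₀ n k
        ≤ (|K| * (1 + |fluct u₀ n k|)) * (C * (1 + |fluct u₀ n k|) *
          exp (-c * fluct u₀ n k ^ 2 + |α| * |fluct u₀ n k|)) :=
          mul_le_mul h4 h3 (rescaledWeight_nonneg α h u₀ n k) (by positivity)
      _ = |K| * C * ((1 + |fluct u₀ n k|) ^ 2 *
          exp (-c * fluct u₀ n k ^ 2 + |α| * |fluct u₀ n k|)) := by ring
      _ ≤ _ := by gcongr
  · intro x k hk
    simp only [hgrid] at hk
    exact (hfF x k hk).mul (tendsto_rescaledWeight hu₀ hlim hk)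

theorem integral_mul_exp_neg_mul_sq_eq_zero (c : ℝ) : ∫ x : ℝ, x * exp (-c * x ^ 2) = 0 := by
  have h := integral_neg_eq_self (fun x : ℝ => x * exp (-c * x ^ 2)) volume
  simp only [neg_sq, neg_mul, integral_neg] at h ⊢
  linarith

theorem integral_gaussian_sub (c μ : ℝ) : ∫ x : ℝ, exp (-c * (x - μ) ^ 2) = √(π / c) := by
  rw [integral_sub_right_eq_self (fun x : ℝ => exp (-c * x ^ 2)) μ, integral_gaussian]

theorem integral_id_mul_gaussian_sub {c : ℝ} (hc : 0 < c) (μ : ℝ) :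
    ∫ x : ℝ, x * exp (-c * (x - μ) ^ 2) = μ * √(π / c) := by
  have h := integral_sub_right_eq_self (μ := volume)
    (fun x : ℝ => (x + μ) * exp (-c * x ^ 2)) μ
  simp only [sub_add_cancel] at h
  rw [h]
  simp only [add_mul]
  rw [integral_add (integrable_mul_exp_neg_mul_sq hc)
    ((integrable_exp_neg_mul_sq hc).const_mul μ), integral_mul_exp_neg_mul_sq_eq_zero,
    integral_const_mul, integral_gaussian, zero_add]

theorem integral_comp_mul_gaussian_sub (φ : ℝ → ℝ) {s : ℝ} (hs : 0 < s) (c μ : ℝ) :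
    ∫ x : ℝ, φ (s * (x - μ)) * exp (-c * (x - μ) ^ 2) =
      s⁻¹ * ∫ y : ℝ, φ y * exp (-c * y ^ 2 / s ^ 2) := by
  rw [integral_sub_right_eq_self (fun x : ℝ => φ (s * x) * exp (-c * x ^ 2)) μ]
  have h := Measure.integral_comp_mul_left (fun y : ℝ => φ y * exp (-c * y ^ 2 / s ^ 2)) s
  rw [abs_of_pos (inv_pos.2 hs), smul_eq_mul] at h
  rw [← h]
  refine integral_congr_ae (Eventually.of_forall fun x => ?_)
  simp only
  congr 2
  field_simp

theorem tendsto_gFun_second_order {α h u₀ : ℝ} (hu₀ : u₀ ∈ Set.Ioo (0 : ℝ) 1)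
    (hmax : ∀ u ∈ Set.Icc (0 : ℝ) 1, gFun α h u ≤ gFun α h u₀) :
    Tendsto (fun u => (gFun α h u - gFun α h u₀) / (u - u₀) ^ 2) (𝓝[≠] u₀)
      (𝓝 (-((1 - 2 * α * u₀ ^ 2 * (1 - u₀)) / (4 * u₀ * (1 - u₀))))) := by
  set g' : ℝ → ℝ := fun u => α / 2 * u ^ 2 + h / 2 - (log u - log (1 - u)) / 2 with hg'
  have hderiv : ∀ u ∈ Set.Ioo (0 : ℝ) 1, HasDerivAt (gFun α h) (g' u) u := by
    intro u hu
    have h0 : u ≠ 0 := hu.1.ne'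
    have h1 : 1 - u ≠ 0 := (sub_pos.2 hu.2).ne'
    have hl : HasDerivAt (fun u : ℝ => 1 - u) (-1) u := (hasDerivAt_id' u).const_sub 1
    have e1 := (hasDerivAt_id' u).mul (Real.hasDerivAt_log h0)
    have e2 := hl.mul (hl.log h1)
    have e3 := ((((hasDerivAt_id' u).fun_pow 3).const_mul (α / 6)).add
      ((hasDerivAt_id' u).const_mul (h / 2))).sub ((e1.add e2).div_const 2)
    convert! e3 using 1
    simp only [hg']
    field_simp
    ring
  have hnhds : Set.Ioo (0 : ℝ) 1 ∈ 𝓝 u₀ := isOpen_Ioo.mem_nhds hu₀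
  have hcrit : g' u₀ = 0 := by
    have hloc : IsLocalMax (gFun α h) u₀ := by
      filter_upwards [hnhds] with u hu using hmax u (Set.Ioo_subset_Icc_self hu)
    exact hloc.hasDerivAt_eq_zero (hderiv u₀ hu₀)
  have h0 : u₀ ≠ 0 := hu₀.1.ne'
  have h1 : 1 - u₀ ≠ 0 := (sub_pos.2 hu₀.2).ne'
  have hl : HasDerivAt (fun u : ℝ => 1 - u) (-1) u₀ := (hasDerivAt_id' u₀).const_sub 1
  have hd := ((((hasDerivAt_id' u₀).fun_pow 2).const_mul (α / 2)).add_const (h / 2)).sub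
    (((Real.hasDerivAt_log h0).sub (hl.log h1)).div_const 2)
  have := tendsto_second_order_quotient (by filter_upwards [hnhds] with u hu using hderiv u hu)
    hcrit hd
  convert this using 2
  field_simp
  ring

theorem continuous_gFun (α h : ℝ) : Continuous (gFun α h) := by
  have h1 := Real.continuous_mul_log
  have h2 : Continuous fun u : ℝ => (1 - u) * log (1 - u) :=
    h1.comp (continuous_const.sub continuous_id)
  unfold gFun
  fun_prop

/-- CLT for the mean-field approximated triangle count off the critical point:
the law of `n·(m³ − m̄_n^Δ)/√6` converges weakly to `𝒩(0, 3(u₀*)⁴/(4c₀))`. -/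
theorem meanField_triangle_CLT_off_critical
    (α h : ℝ) (hα : α > -2) (hne : (α, h) ≠ ((27 : ℝ) / 8, Real.log 2 - 3 / 2))
    (u₀ : ℝ) (hu₀ : u₀ ∈ Set.Ioo (0 : ℝ) 1)
    (hmax : ∀ u ∈ Set.Icc (0 : ℝ) 1, gFun α h u ≤ gFun α h u₀)
    (huniq : ∀ u ∈ Set.Icc (0 : ℝ) 1, gFun α h u = gFun α h u₀ → u = u₀)
    (c₀ v : ℝ)
    (hc₀ : c₀ = (1 - 2 * α * u₀ ^ 2 * (1 - u₀)) / (4 * u₀ * (1 - u₀)))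
    (hc₀pos : 0 < c₀)
    (hv : v = 3 * u₀ ^ 4 / (4 * c₀)) :
    ∀ φ : ℝ → ℝ, Continuous φ → (∃ M : ℝ, ∀ x, |φ x| ≤ M) →
      Tendsto
        (fun n : ℕ => mfExp α h n
          (fun m => φ ((n : ℝ) * (m ^ 3 - mfExp α h n (fun m' => m' ^ 3)) / Real.sqrt 6)))
        atTop
        (nhds (∫ y : ℝ,
          φ y * ((Real.sqrt (2 * Real.pi * v))⁻¹ * Real.exp (-(y ^ 2) / (2 * v))))) := by
  intro φ hφ ⟨M, hM⟩
  have hlim := tendsto_gFun_second_order hu₀ hmax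
  rw [← hc₀] at hlim
  have hquad := exists_quadratic_upper_bound isCompact_Icc (continuous_gFun α h).continuousOn
    (Set.Ioo_subset_Icc_self hu₀)
    (fun u hu hne => lt_of_le_of_ne (hmax u hu) fun heq => hne (huniq u hu heq))
    (neg_lt_zero.2 hc₀pos) hlim
  set μ : ℝ := -(α * u₀ ^ 2) / (2 * c₀) with hμ
  set A : ℝ := (√π)⁻¹ * (√(u₀ * (1 - u₀)))⁻¹ * exp (c₀ * μ ^ 2) with hA
  have hA0 : 0 < A := by
    have : 0 < u₀ * (1 - u₀) := mul_pos hu₀.1 (sub_pos.2 hu₀.2)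
    positivity
  have hG : ∀ x, (√π)⁻¹ * (√(u₀ * (1 - u₀)))⁻¹ * exp (-c₀ * x ^ 2 - α * u₀ ^ 2 * x) =
      A * exp (-c₀ * (x - μ) ^ 2) := by
    intro x
    rw [hA, mul_assoc _ (exp _) (exp _), ← exp_add]
    congr 2
    rw [hμ]
    field_simp
    ring
  set W := rescaledWeight α h u₀
  set R : (ℕ → ℕ → ℝ) → ℕ → ℝ := fun f n =>
    (∑ k ∈ Finset.range (edgeCount n + 1), f n k * W n k) /
      ∑ k ∈ Finset.range (edgeCount n + 1), W n k with hR
  have hone : Tendsto (fun n => (n / edgeCount n : ℝ) *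
      ∑ k ∈ Finset.range (edgeCount n + 1), W n k) atTop (𝓝 (A * √(π / c₀))) := by
    have := tendsto_sum_rescaledWeight hu₀ hquad hlim (f := fun _ _ => 1) (F := fun _ => 1)
      (K := 1) (Eventually.of_forall fun n k _ => by simp) (fun _ _ _ => tendsto_const_nhds)
    simpa only [one_mul, hG, integral_const_mul, integral_gaussian_sub] using this
  have hZ0 : 0 < A * √(π / c₀) := by positivity
  have hpos : ∀ᶠ n in atTop, (n / edgeCount n : ℝ) ≠ 0 ∧
      ∑ k ∈ Finset.range (edgeCount n + 1), W n k ≠ 0 := by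
    filter_upwards [hone.eventually_const_lt hZ0] with n hn
    exact ⟨left_ne_zero_of_mul hn.ne', right_ne_zero_of_mul hn.ne'⟩
  have hratio : ∀ {f : ℕ → ℕ → ℝ} {F : ℝ → ℝ} {K : ℝ},
      (∀ᶠ n in atTop, ∀ k ≤ edgeCount n, |f n k| ≤ K * (1 + |fluct u₀ n k|)) →
      (∀ (x : ℝ) (k : ℕ → ℕ), Tendsto (fun n => fluct u₀ n (k n)) atTop (𝓝 x) →
        Tendsto (fun n => f n (k n)) atTop (𝓝 (F x))) →
      Tendsto (R f) atTop (𝓝 ((∫ x, F x * exp (-c₀ * (x - μ) ^ 2)) / √(π / c₀))) := by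
    intro f F K hK hF
    have h1 := (tendsto_sum_rescaledWeight hu₀ hquad hlim hK hF).div hone hZ0.ne'
    simp only [hG, mul_left_comm (F _), integral_const_mul] at h1
    rw [mul_div_mul_left _ _ hA0.ne'] at h1
    refine h1.congr' ?_
    filter_upwards [hpos] with n hn
    exact mul_div_mul_left _ _ hn.1
  set d : ℕ → ℕ → ℝ := fun n k => n * ((k / edgeCount n : ℝ) ^ 3 - u₀ ^ 3) with hd
  have hdlim : ∀ (x : ℝ) (k : ℕ → ℕ), Tendsto (fun n => fluct u₀ n (k n)) atTop (𝓝 x) →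
      Tendsto (fun n => d n (k n)) atTop (𝓝 (3 * u₀ ^ 2 * x)) := by
    intro x k hk
    have hp := tendsto_div_edgeCount hk
    have h1 := (((hp.pow 2).add (hp.mul_const u₀)).add_const (u₀ ^ 2)).mul hk
    rw [show u₀ ^ 2 + u₀ * u₀ + u₀ ^ 2 = 3 * u₀ ^ 2 by ring] at h1
    refine h1.congr fun n => ?_
    simp only [hd, fluct]
    ring
  have hmean : Tendsto (R d) atTop (𝓝 (3 * u₀ ^ 2 * μ)) := by
    have h1 := hratio (K := 3) (Eventually.of_forall fun n k hk => ?_) hdlim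
    · simp only [mul_assoc (3 * u₀ ^ 2), integral_const_mul,
        integral_id_mul_gaussian_sub hc₀pos] at h1
      convert h1 using 2
      have : √(π / c₀) ≠ 0 := by positivity
      field_simp
    · have h2 := abs_cube_sub_cube_le (div_edgeCount_mem_Icc hk) (Set.Ioo_subset_Icc_self hu₀)
      simp only [hd, fluct, abs_mul, Nat.abs_cast]
      have h3 := mul_le_mul_of_nonneg_left h2 (Nat.cast_nonneg (α := ℝ) n)
      linarith
  set s : ℝ := 3 * u₀ ^ 2 / √6 with hs
  have hs0 : 0 < s := by
    have := hu₀.1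
    positivity
  have hφlim := hratio (f := fun n k => φ ((1 - 1 / (n : ℝ)) ^ 3 * (d n k - R d n) / √6))
    (F := fun x => φ (s * (x - μ))) (K := M) (Eventually.of_forall fun n k _ => ?_) ?_
  · rw [integral_comp_mul_gaussian_sub φ hs0] at hφlim
    have hs2 : s ^ 2 = 3 * u₀ ^ 4 / 2 := by
      rw [hs, div_pow, sq_sqrt (by norm_num)]
      ring
    have hu0 : u₀ ≠ 0 := hu₀.1.ne'
    have hsv : √(2 * π * v) = s * √(π / c₀) := by
      rw [← sqrt_sq hs0.le, ← sqrt_mul (by positivity), hs2, hv]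
      congr 1
      field_simp
      ring
    have hval : (s⁻¹ * ∫ y : ℝ, φ y * exp (-c₀ * y ^ 2 / s ^ 2)) / √(π / c₀) =
        ∫ y : ℝ, φ y * ((√(2 * π * v))⁻¹ * exp (-(y ^ 2) / (2 * v))) := by
      rw [mul_div_right_comm, ← integral_const_mul]
      refine integral_congr_ae (Eventually.of_forall fun y => ?_)
      have he : -c₀ * y ^ 2 / s ^ 2 = -(y ^ 2) / (2 * v) := by
        rw [hs2, hv]
        field_simp
        norm_num
      simp only [he, hsv, mul_inv, div_eq_mul_inv]
      ring
    rw [hval] at hφlim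
    refine hφlim.congr' ?_
    filter_upwards [hpos, eventually_ge_atTop 2] with n hn hn2
    have hn0 : (n : ℝ) ≠ 0 := by
      have : n ≠ 0 := by omega
      exact_mod_cast this
    have hcube : ∀ k, mfDensity n k ^ 3 = (1 - 1 / (n : ℝ)) ^ 3 * (u₀ ^ 3 + d n k / n) := by
      intro k
      rw [mfDensity_eq hn2]
      simp only [hd]
      field_simp
      ring
    have hEcube : mfExp α h n (fun m => m ^ 3) =
        (1 - 1 / (n : ℝ)) ^ 3 * (u₀ ^ 3 + R d n / n) := by
      rw [mfExp_eq α h u₀ hn2, div_eq_iff hn.2]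
      simp only [hcube, mul_assoc, add_mul, div_mul_eq_mul_div]
      rw [← Finset.mul_sum, Finset.sum_add_distrib, ← Finset.mul_sum, ← Finset.sum_div]
      simp only [hR]
      field_simp [hn.2]
      rfl
    rw [mfExp_eq α h u₀ hn2, hEcube]
    simp only [hcube, hR]
    congr 1
    refine Finset.sum_congr rfl fun k _ => ?_
    congr 2
    field_simp
    ring
  · have hM0 : 0 ≤ M := (abs_nonneg _).trans (hM 0)
    exact (hM _).trans (le_mul_of_one_le_right hM0 (by linarith [abs_nonneg (fluct u₀ n k)]))
  · intro x k hk
    refine (hφ.tendsto _).comp ?_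
    have h1 := (((tendsto_one_sub_one_div_natCast.pow 3).mul
      ((hdlim x k hk).sub hmean))).div_const (√6)
    convert h1 using 2
    rw [hs]
    ring
end

section
/- Conditional central limit theorem on the critical curve (Theorem 3.13, second part): Assume α > −2 and that g_{α,h} attains its maximum over [0,1] at exactly two points 0 < u₁* < u₂* < 1, and for i ∈ {1,2} assume c_i := (1 − 2α(u_i*)²(1−u_i*))/(4u_i*(1−u_i*)) > 0. Fix δ ∈ (1/2, 1), and let ℙ̂^{(i)}_{n;α,h} be the conditional mean-field measure given B_{u_i*}(n,δ), and set m̂_n^{(i)} = Σ_m m³·ℙ̂^{(i)}_{n;α,h}({m}). Then the law of the random variable m ↦ n·(m³ − m̂_n^{(i)})/√6 under ℙ̂^{(i)}_{n;α,h} converges weakly, as n → ∞, to the centered Gaussian distribution with variance v̄_i^Δ = 3(u_i*)⁴/(4c_i). -/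
open scoped Classical
open Filter MeasureTheory

/-- The conditioning event `B_{u*}(n,δ) = {m : |m − u*| ≤ n^{−δ}}` (as a set of reals). -/
noncomputable def mfBall (n : ℕ) (δ u : ℝ) : Set ℝ :=
  {m : ℝ | |m - u| ≤ (n : ℝ) ^ (-δ)}

/-- Conditional mean-field probability of `A` given the event `B`. -/
noncomputable def mfCondProb (α h : ℝ) (n : ℕ) (B A : Set ℝ) : ℝ :=
  mfProb α h n (A ∩ B) / mfProb α h n B

/-- Conditional mean-field expectation of `f(m)` given the event `B`. -/
noncomputable def mfCondExp (α h : ℝ) (n : ℕ) (B : Set ℝ) (f : ℝ → ℝ) : ℝ :=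
  (∑ k ∈ Finset.range (n * (n - 1) / 2 + 1),
      if mfDensity n k ∈ B then f (mfDensity n k) * mfWeight α h n k else 0) /
  (∑ k ∈ Finset.range (n * (n - 1) / 2 + 1),
      if mfDensity n k ∈ B then mfWeight α h n k else 0)

/-- The logarithmic ratio of consecutive mean-field weights at density `m`, with `ε = 1/n`. -/
noncomputable def mfLogRatio (α h m ε : ℝ) : ℝ :=
  Real.log (1 - ε - m) - Real.log (m + 2 * ε ^ 2) +
    α * (m ^ 2 + 2 * m * ε ^ 2 + 4 / 3 * ε ^ 4) + h

/-- The fluctuation `n (m - u)` of the density with `k` edges around `u`. -/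
noncomputable def mfScaled (u : ℝ) (n k : ℕ) : ℝ := n * (mfDensity n k - u)

/-- The indices `k` whose density lies in the conditioning event. -/
noncomputable def mfWindow (δ u : ℝ) (n : ℕ) : Finset ℕ :=
  (Finset.range (n * (n - 1) / 2 + 1)).filter fun k => mfDensity n k ∈ mfBall n δ u

lemma cast_edges (n : ℕ) : ((n * (n - 1) / 2 : ℕ) : ℝ) = n * (n - 1) / 2 := by
  rw [Nat.cast_div (Nat.even_mul_pred_self n).two_dvd (by norm_num)]
  rcases n with _ | n <;> simp

lemma gFun_critical {α h u : ℝ} (h0 : 0 < u) (h1 : u < 1)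
    (hmax : ∀ v ∈ Set.Icc (0 : ℝ) 1, gFun α h v ≤ gFun α h u) :
    Real.log (1 - u) - Real.log u + α * u ^ 2 + h = 0 := by
  have hl : IsLocalMax (gFun α h) u := by
    filter_upwards [Icc_mem_nhds h0 h1] with v hv using hmax v hv
  have hlog := (Real.hasDerivAt_log h0.ne')
  have hsub : HasDerivAt (fun v : ℝ => 1 - v) (-1) u := by
    simpa using (hasDerivAt_id u).const_sub 1
  have hlog' := hsub.log (sub_pos.2 h1).ne'
  have hd := ((((hasDerivAt_id u).pow 3).const_mul (α / 6)).add
    ((hasDerivAt_id u).const_mul (h / 2))).sub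
    ((((hasDerivAt_id u).mul hlog).add (hsub.mul hlog')).div_const 2)
  have := hl.hasDerivAt_eq_zero (f := gFun α h) hd
  have hu : (1 - u) ≠ 0 := (sub_pos.2 h1).ne'
  simp only [id] at this
  field_simp at this
  norm_num at this
  linarith

lemma mfLogRatio_expansion {α h u : ℝ} (h0 : 0 < u) (h1 : u < 1)
    (hcrit : Real.log (1 - u) - Real.log u + α * u ^ 2 + h = 0) {η : ℝ} (hη : 0 < η) :
    ∃ r > 0, ∀ m ε : ℝ, |m - u| < r → |ε| < r →
      |mfLogRatio α h m ε +
        4 * ((1 - 2 * α * u ^ 2 * (1 - u)) / (4 * u * (1 - u))) * (m - u) + ε / (1 - u)| ≤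
      η * (|m - u| + |ε|) := by
  have hu : (1 - u) ≠ 0 := (sub_pos.2 h1).ne'
  have hm := hasFDerivAt_fst (𝕜 := ℝ) (p := ((u, 0) : ℝ × ℝ))
  have he := hasFDerivAt_snd (𝕜 := ℝ) (p := ((u, 0) : ℝ × ℝ))
  have d1 := ((he.const_sub 1).sub hm).log (by simpa using hu)
  have d2 := (hm.add ((he.pow 2).const_mul 2)).log (by simpa using h0.ne')
  have d3 := ((((hm.pow 2).add ((hm.const_mul 2).mul (he.pow 2))).add
    ((he.pow 4).const_mul (4 / 3))).const_mul α)
  have d := ((d1.sub d2).add d3).add_const h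
  have hb := d.isLittleO.bound hη
  rw [Metric.eventually_nhds_iff] at hb
  obtain ⟨r, hr, hb⟩ := hb
  refine ⟨r, hr, fun m ε hmr hεr => ?_⟩
  have := hb (y := (m, ε)) (by
    rw [Prod.dist_eq]; simpa [Real.dist_eq] using ⟨hmr, hεr⟩)
  refine le_trans (le_of_eq ?_) (this.trans ?_)
  · rw [Real.norm_eq_abs]
    congr 1
    simp [mfLogRatio]
    field_simp
    linear_combination (3 * u * (1 - u)) * hcrit
  · gcongr
    simp only [Prod.norm_def, Prod.fst_sub, Prod.snd_sub, Real.norm_eq_abs, sub_zero]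
    exact max_le_add_of_nonneg (abs_nonneg _) (abs_nonneg _)

lemma log_mfWeight_succ_sub {α h : ℝ} {n k : ℕ} (hn : 0 < n) (hk : k < n * (n - 1) / 2) :
    Real.log (mfWeight α h n (k + 1)) - Real.log (mfWeight α h n k) =
      mfLogRatio α h (mfDensity n k) (1 / n) := by
  have hn' : (0 : ℝ) < n := by exact_mod_cast hn
  have hN := cast_edges n
  set N := n * (n - 1) / 2 with hNdef
  have c0 : (0 : ℝ) < N.choose k := by exact_mod_cast Nat.choose_pos hk.le
  have c1 : (0 : ℝ) < N.choose (k + 1) := by exact_mod_cast Nat.choose_pos hk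
  have hs : ((N.choose (k + 1) : ℝ)) * (k + 1) = N.choose k * (N - k) := by
    have := Nat.choose_succ_right_eq N k
    rw [← Nat.cast_sub hk.le]; exact_mod_cast this
  have hNk : (0 : ℝ) < N - k := by rw [sub_pos]; exact_mod_cast hk
  have hlog : Real.log (N.choose (k + 1)) + Real.log (k + 1) =
      Real.log (N.choose k) + Real.log (N - k) := by
    rw [← Real.log_mul c1.ne' (by positivity), hs, Real.log_mul c0.ne' hNk.ne']
  have e1 : Real.log (1 - 1 / n - mfDensity n k) = Real.log (N - k) + Real.log (2 / n ^ 2) := by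
    rw [← Real.log_mul hNk.ne' (by positivity), hN, mfDensity]
    congr 1; field_simp
  have e2 : Real.log (mfDensity n k + 2 * (1 / n) ^ 2) =
      Real.log (k + 1) + Real.log (2 / n ^ 2) := by
    rw [← Real.log_mul (by positivity) (by positivity), mfDensity]
    congr 1; field_simp
  rw [mfLogRatio, e1, e2, mfWeight, mfWeight, Real.log_mul c1.ne' (Real.exp_pos _).ne',
    Real.log_mul c0.ne' (Real.exp_pos _).ne', Real.log_exp, Real.log_exp]
  simp only [mfDensity]
  push_cast
  have : Real.log (N.choose (k + 1)) = Real.log (N.choose k) + Real.log (N - k)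
    - Real.log (k + 1) := by linarith
  rw [this]
  field_simp
  ring

lemma mem_mfWindow {δ u : ℝ} {n k : ℕ} :
    k ∈ mfWindow δ u n ↔ k < n * (n - 1) / 2 + 1 ∧ |mfDensity n k - u| ≤ (n : ℝ) ^ (-δ) := by
  rw [mfWindow, Finset.mem_filter, Finset.mem_range]
  rfl

lemma mfScaled_succ {u : ℝ} {n k : ℕ} (hn : 0 < n) :
    mfScaled u n (k + 1) = mfScaled u n k + 2 / n := by
  have : (n : ℝ) ≠ 0 := by exact_mod_cast hn.ne'
  simp only [mfScaled, mfDensity]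
  push_cast
  field_simp
  ring

lemma abs_mfScaled (u : ℝ) (n k : ℕ) : |mfScaled u n k| = n * |mfDensity n k - u| := by
  rw [mfScaled, abs_mul, Nat.abs_cast]

lemma tendsto_natCast_rpow_neg {δ : ℝ} (hδ : 0 < δ) :
    Tendsto (fun n : ℕ => (n : ℝ) ^ (-δ)) atTop (nhds 0) :=
  (tendsto_rpow_neg_atTop hδ).comp tendsto_natCast_atTop_atTop

lemma eventually_lt_edges_of_mem_mfWindow {δ u : ℝ} (h1 : u < 1) (hδ : 0 < δ) :
    ∀ᶠ n : ℕ in atTop, ∀ k ∈ mfWindow δ u n, k < n * (n - 1) / 2 := by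
  have hlim : Tendsto (fun n : ℕ => u + (n : ℝ) ^ (-δ) + 1 / n) atTop (nhds (u + 0 + 0)) :=
    (tendsto_const_nhds.add (tendsto_natCast_rpow_neg hδ)).add tendsto_one_div_atTop_nhds_zero_nat
  filter_upwards [hlim.eventually_lt_const (by simpa using h1 : u + 0 + 0 < 1),
    eventually_gt_atTop 0] with n hn hn0 k hk
  have hn' : (0 : ℝ) < n := by exact_mod_cast hn0
  have hm := (abs_le.1 (mem_mfWindow.1 hk).2).2
  have : mfDensity n k < 1 - 1 / n := by linarith
  rw [mfDensity, div_lt_iff₀ (by positivity)] at this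
  have e : (1 - 1 / (n : ℝ)) * n ^ 2 = n * (n - 1) := by field_simp
  rw [← Nat.cast_lt (α := ℝ), cast_edges]
  linarith

/-- The logarithm of a mean-field weight minus its Gaussian approximation. -/
noncomputable def mfLogError (α h c μ u : ℝ) (n k : ℕ) : ℝ :=
  Real.log (mfWeight α h n k) + c * (mfScaled u n k - μ) ^ 2

lemma mfLogError_increment {α h u c μ δ : ℝ} (h0 : 0 < u) (h1 : u < 1)
    (hcrit : Real.log (1 - u) - Real.log u + α * u ^ 2 + h = 0)
    (hc : c = (1 - 2 * α * u ^ 2 * (1 - u)) / (4 * u * (1 - u)))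
    (hμ : 4 * c * μ = -(1 / (1 - u))) (hδ : 0 < δ) {η : ℝ} (hη : 0 < η) :
    ∀ᶠ n : ℕ in atTop, ∀ k ∈ mfWindow δ u n,
      |mfLogError α h c μ u n (k + 1) - mfLogError α h c μ u n k| ≤
        η * (|mfScaled u n k| + 1) / n := by
  obtain ⟨r, hr, hexp⟩ := mfLogRatio_expansion (α := α) (h := h) h0 h1 hcrit (half_pos hη)
  have hlim : Tendsto (fun n : ℕ => 4 * |c| * (1 / (n : ℝ))) atTop (nhds (4 * |c| * 0)) :=
    tendsto_const_nhds.mul tendsto_one_div_atTop_nhds_zero_nat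
  filter_upwards [eventually_lt_edges_of_mem_mfWindow h1 hδ, eventually_gt_atTop 0,
    (tendsto_natCast_rpow_neg hδ).eventually_lt_const hr,
    (tendsto_one_div_atTop_nhds_zero_nat (𝕜 := ℝ)).eventually_lt_const hr,
    hlim.eventually_lt_const (by simpa using half_pos hη : 4 * |c| * 0 < η / 2)]
    with n hlt hn hr1 hr2 hcη k hk
  have hn' : (0 : ℝ) < n := by exact_mod_cast hn
  have hε : |1 / (n : ℝ)| = 1 / n := abs_of_pos (by positivity)
  have key := hexp (mfDensity n k) (1 / n) ((mem_mfWindow.1 hk).2.trans_lt hr1) (hε.trans_lt hr2)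
  rw [hε, ← hc] at key
  have hrat := log_mfWeight_succ_sub (α := α) (h := h) hn (hlt k hk)
  have e : mfLogError α h c μ u n (k + 1) - mfLogError α h c μ u n k =
      (mfLogRatio α h (mfDensity n k) (1 / n) + 4 * c * (mfDensity n k - u) +
        1 / n / (1 - u)) + 4 * c * (1 / n) * (1 / n) := by
    rw [← hrat, mfLogError, mfLogError, mfScaled_succ hn, mfScaled]
    have : (1 : ℝ) / n / (1 - u) = -(4 * c * μ) / n := by rw [hμ]; field_simp
    rw [this]
    field_simp
    ring
  rw [e, abs_mfScaled]
  refine (abs_add_le _ _).trans ?_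
  have h2 : |4 * c * (1 / (n : ℝ)) * (1 / n)| ≤ η / 2 * (1 / n) := by
    rw [abs_mul, hε]
    gcongr
    rw [abs_mul, abs_mul, hε, abs_of_pos (by norm_num : (0 : ℝ) < 4)]
    exact hcη.le
  have e3 : η * (n * |mfDensity n k - u| + 1) / n =
      η / 2 * (|mfDensity n k - u| + 1 / n) + η / 2 * (1 / n) +
        η / 2 * |mfDensity n k - u| := by
    field_simp
    ring
  have : 0 ≤ η / 2 * |mfDensity n k - u| := by positivity
  rw [e3]
  linarith

lemma mfScaled_mono {u : ℝ} {n k l : ℕ} (hkl : k ≤ l) : mfScaled u n k ≤ mfScaled u n l := by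
  unfold mfScaled mfDensity
  gcongr

lemma mfScaled_sub {u : ℝ} {n : ℕ} (hn : 0 < n) (k l : ℕ) :
    (l : ℝ) - k = n / 2 * (mfScaled u n l - mfScaled u n k) := by
  have : (n : ℝ) ≠ 0 := by exact_mod_cast hn.ne'
  simp only [mfScaled, mfDensity]
  field_simp
  ring

lemma mem_mfWindow_of_le_of_le {δ u : ℝ} {n k i l : ℕ} (hk : k ∈ mfWindow δ u n)
    (hl : l ∈ mfWindow δ u n) (hki : k ≤ i) (hil : i ≤ l) : i ∈ mfWindow δ u n := by
  rw [mem_mfWindow] at *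
  refine ⟨by omega, abs_le.2 ⟨(abs_le.1 hk.2).1.trans ?_, le_trans ?_ (abs_le.1 hl.2).2⟩⟩ <;>
  · unfold mfDensity
    gcongr

lemma abs_mfLogError_sub_le_of_le {α h u c μ δ η : ℝ} (hη : 0 < η) {n : ℕ} (hn : 0 < n)
    (hinc : ∀ k ∈ mfWindow δ u n,
      |mfLogError α h c μ u n (k + 1) - mfLogError α h c μ u n k| ≤
        η * (|mfScaled u n k| + 1) / n)
    {k l : ℕ} (hk : k ∈ mfWindow δ u n) (hl : l ∈ mfWindow δ u n) (hkl : k ≤ l) :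
    |mfLogError α h c μ u n l - mfLogError α h c μ u n k| ≤
      η / 2 * |mfScaled u n l - mfScaled u n k| *
        (|mfScaled u n k| + |mfScaled u n l| + 1) := by
  have hn' : (0 : ℝ) < n := by exact_mod_cast hn
  have hsum := dist_le_Ico_sum_of_dist_le (f := mfLogError α h c μ u n) (m := k) (n := l)
    (d := fun _ => η * (|mfScaled u n k| + |mfScaled u n l| + 1) / n) hkl (by
      intro i hki hil
      rw [dist_comm, Real.dist_eq]
      refine (hinc i (mem_mfWindow_of_le_of_le hk hl hki hil.le)).trans ?_
      have hx : |mfScaled u n i| ≤ |mfScaled u n k| + |mfScaled u n l| := by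
        have h1 := mfScaled_mono (u := u) (n := n) hki
        have h2 := mfScaled_mono (u := u) (n := n) hil.le
        rw [abs_le]
        constructor
        · linarith [neg_abs_le (mfScaled u n k), abs_nonneg (mfScaled u n l)]
        · linarith [le_abs_self (mfScaled u n l), abs_nonneg (mfScaled u n k)]
      gcongr)
  rw [dist_comm, Real.dist_eq, Finset.sum_const, Nat.card_Ico, nsmul_eq_mul,
    Nat.cast_sub hkl, mfScaled_sub (u := u) hn] at hsum
  rw [abs_of_nonneg (sub_nonneg.2 (mfScaled_mono hkl))]
  refine hsum.trans (le_of_eq ?_)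
  field_simp

/-- The index whose scaled density is closest to `y` from below. -/
noncomputable def mfIndex (u y : ℝ) (n : ℕ) : ℕ := ⌊(n : ℝ) ^ 2 * u / 2 + n * y / 2⌋₊

lemma mem_Ico_mfScaled_iff {u y : ℝ} {n k : ℕ} (hn : 0 < n) :
    y ∈ Set.Ico (mfScaled u n k) (mfScaled u n k + 2 / n) ↔
      (k : ℝ) ≤ (n : ℝ) ^ 2 * u / 2 + n * y / 2 ∧ (n : ℝ) ^ 2 * u / 2 + n * y / 2 < k + 1 := by
  have hn' : (0 : ℝ) < n := by exact_mod_cast hn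
  have e : y - mfScaled u n k = ((n : ℝ) ^ 2 * u / 2 + n * y / 2 - k) * (2 / n) := by
    rw [mfScaled, mfDensity]; field_simp; ring
  have hp : (0 : ℝ) < 2 / n := by positivity
  rw [Set.mem_Ico, ← sub_nonneg, ← sub_lt_iff_lt_add', e, mul_nonneg_iff_of_pos_right hp,
    sub_nonneg, mul_lt_iff_lt_one_left hp, sub_lt_iff_lt_add, add_comm (1 : ℝ)]

lemma mfIndex_eq_of_mem_Ico {u y : ℝ} {n k : ℕ} (hn : 0 < n)
    (hy : y ∈ Set.Ico (mfScaled u n k) (mfScaled u n k + 2 / n)) : mfIndex u y n = k := by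
  rw [mem_Ico_mfScaled_iff hn] at hy
  exact (Nat.floor_eq_iff ((Nat.cast_nonneg k).trans hy.1)).2 hy

lemma eventually_mem_Ico_mfIndex {u : ℝ} (h0 : 0 < u) (y : ℝ) :
    ∀ᶠ n : ℕ in atTop, y ∈ Set.Ico (mfScaled u n (mfIndex u y n))
      (mfScaled u n (mfIndex u y n) + 2 / n) := by
  have hlim : Tendsto (fun n : ℕ => u + y * (1 / (n : ℝ))) atTop (nhds (u + y * 0)) :=
    tendsto_const_nhds.add (tendsto_const_nhds.mul tendsto_one_div_atTop_nhds_zero_nat)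
  filter_upwards [eventually_gt_atTop 0,
    hlim.eventually_const_lt (by simpa using h0 : 0 < u + y * 0)] with n hn hpos
  have hn' : (0 : ℝ) < n := by exact_mod_cast hn
  rw [mem_Ico_mfScaled_iff hn]
  refine ⟨Nat.floor_le ?_, Nat.lt_floor_add_one _⟩
  have : (n : ℝ) ^ 2 * u / 2 + n * y / 2 = n ^ 2 / 2 * (u + y * (1 / n)) := by field_simp
  rw [this]
  positivity

lemma eventually_mfScaled_mfIndex_near {u : ℝ} (h0 : 0 < u) (y : ℝ) :
    ∀ᶠ n : ℕ in atTop, |mfScaled u n (mfIndex u y n) - y| ≤ 2 / n := by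
  filter_upwards [eventually_mem_Ico_mfIndex h0 y] with n hn
  have : (0 : ℝ) ≤ 2 / n := by positivity
  rw [abs_le]
  constructor <;> linarith [hn.1, hn.2]

lemma tendsto_mfScaled_mfIndex {u : ℝ} (h0 : 0 < u) (y : ℝ) :
    Tendsto (fun n => mfScaled u n (mfIndex u y n)) atTop (nhds y) := by
  rw [tendsto_iff_dist_tendsto_zero]
  exact squeeze_zero' (Eventually.of_forall fun _ => dist_nonneg)
    (eventually_mfScaled_mfIndex_near h0 y) (tendsto_const_div_atTop_nhds_zero_nat 2)

lemma eventually_mfIndex_mem {u δ : ℝ} (h0 : 0 < u) (h1 : u < 1) (hδ : δ < 1) (y : ℝ) :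
    ∀ᶠ n : ℕ in atTop, mfIndex u y n ∈ mfWindow δ u n := by
  have hx := tendsto_mfScaled_mfIndex h0 y
  have hpow : Tendsto (fun n : ℕ => (n : ℝ) ^ (1 - δ)) atTop atTop :=
    (tendsto_rpow_atTop (sub_pos.2 hδ)).comp tendsto_natCast_atTop_atTop
  have hlim : Tendsto (fun n : ℕ => u + mfScaled u n (mfIndex u y n) * (1 / (n : ℝ)) + 1 / n)
      atTop (nhds (u + y * 0 + 0)) :=
    (tendsto_const_nhds.add (hx.mul tendsto_one_div_atTop_nhds_zero_nat)).add
      tendsto_one_div_atTop_nhds_zero_nat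
  filter_upwards [eventually_gt_atTop 0, hpow.eventually_gt_atTop (|y| + 1),
    hx.abs.eventually_lt_const (lt_add_one |y|),
    hlim.eventually_lt_const (by simpa using h1 : u + y * 0 + 0 < 1)] with n hn hp hxy hl
  have hn' : (0 : ℝ) < n := by exact_mod_cast hn
  generalize mfIndex u y n = k at *
  rw [mem_mfWindow]
  constructor
  · have e : u + mfScaled u n k * (1 / (n : ℝ)) = mfDensity n k := by
      rw [mfScaled]; field_simp; ring
    rw [e] at hl
    have : mfDensity n k < 1 - 1 / n := by linarith
    rw [mfDensity, div_lt_iff₀ (by positivity)] at this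
    have e : (1 - 1 / (n : ℝ)) * n ^ 2 = n * (n - 1) := by field_simp
    refine Nat.lt_succ_of_lt ?_
    rw [← Nat.cast_lt (α := ℝ), cast_edges]
    linarith
  · have := (hxy.trans hp).le
    rw [abs_mfScaled, show 1 - δ = 1 + -δ by ring, Real.rpow_add hn', Real.rpow_one] at this
    exact le_of_mul_le_mul_left this hn'

lemma mfLogError_bound {α h u c μ δ : ℝ} (h0 : 0 < u) (h1 : u < 1)
    (hcrit : Real.log (1 - u) - Real.log u + α * u ^ 2 + h = 0)
    (hc : c = (1 - 2 * α * u ^ 2 * (1 - u)) / (4 * u * (1 - u)))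
    (hμ : 4 * c * μ = -(1 / (1 - u))) (hδ : 0 < δ) (hδ1 : δ < 1) {η : ℝ} (hη : 0 < η) :
    ∀ᶠ n : ℕ in atTop, ∀ k ∈ mfWindow δ u n,
      |mfLogError α h c μ u n k - mfLogError α h c μ u n (mfIndex u 0 n)| ≤
        η * (|mfScaled u n k| + 2) ^ 2 := by
  filter_upwards [mfLogError_increment h0 h1 hcrit hc hμ hδ hη,
    eventually_mfScaled_mfIndex_near h0 0, eventually_mfIndex_mem h0 h1 hδ1 0,
    eventually_ge_atTop 2] with n hinc hnear hmem hn k hk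
  have hn' : (2 : ℝ) ≤ n := by exact_mod_cast hn
  have h01 : |mfScaled u n (mfIndex u 0 n)| ≤ 1 := by
    rw [sub_zero] at hnear
    exact hnear.trans ((div_le_one (by linarith)).2 hn')
  set l := mfIndex u 0 n
  have main : |mfLogError α h c μ u n k - mfLogError α h c μ u n l| ≤
      η / 2 * |mfScaled u n k - mfScaled u n l| *
        (|mfScaled u n k| + |mfScaled u n l| + 1) := by
    rcases le_total k l with hkl | hkl
    · rw [abs_sub_comm, abs_sub_comm (mfScaled u n k)]
      exact abs_mfLogError_sub_le_of_le hη (by omega) hinc hk hmem hkl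
    · rw [add_comm |mfScaled u n k|]
      exact abs_mfLogError_sub_le_of_le hη (by omega) hinc hmem hk hkl
  refine main.trans ?_
  have h3 : |mfScaled u n k - mfScaled u n l| ≤ |mfScaled u n k| + 2 :=
    (abs_sub _ _).trans (by linarith)
  calc _ ≤ η / 2 * (|mfScaled u n k| + 2) * (|mfScaled u n k| + 2) := by
        have h4 : |mfScaled u n k| + |mfScaled u n l| + 1 ≤ |mfScaled u n k| + 2 := by linarith
        gcongr
    _ ≤ η * (|mfScaled u n k| + 2) ^ 2 := by
        rw [mul_assoc, ← sq]; gcongr; linarith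

/-- Riemann sums over the scaled lattice converge to the integral, under Gaussian domination. -/
lemma tendsto_sum_mfScaled {u C β : ℝ} (h0 : 0 < u) (hβ : 0 < β) (S : ℕ → Finset ℕ)
    (a : ℕ → ℕ → ℝ) (F : ℝ → ℝ) (hC : 0 ≤ C)
    (hbound : ∀ᶠ n in atTop, ∀ k ∈ S n, |a n k| ≤ C * Real.exp (-β * mfScaled u n k ^ 2))
    (hlim : ∀ y, Tendsto (fun n => a n (mfIndex u y n)) atTop (nhds (F y)))
    (hmem : ∀ y, ∀ᶠ n in atTop, mfIndex u y n ∈ S n) :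
    Tendsto (fun n : ℕ => 2 / (n : ℝ) * ∑ k ∈ S n, a n k) atTop (nhds (∫ y, F y)) := by
  set I : ℕ → ℕ → Set ℝ := fun n k => Set.Ico (mfScaled u n k) (mfScaled u n k + 2 / n) with hI
  set G : ℕ → ℝ → ℝ := fun n y => ∑ k ∈ S n, (I n k).indicator (fun _ => a n k) y with hG
  have hGeq : ∀ n, 0 < n → ∀ k ∈ S n, ∀ y ∈ I n k, G n y = a n k := by
    intro n hn k hk y hy
    simp only [hG]
    rw [Finset.sum_eq_single_of_mem k hk, Set.indicator_of_mem hy]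
    intro l _ hlk
    refine Set.indicator_of_notMem (fun hl => hlk ?_) _
    rw [← mfIndex_eq_of_mem_Ico hn hl, ← mfIndex_eq_of_mem_Ico hn hy]
  have hint : ∀ n, ∫ y, G n y = 2 / (n : ℝ) * ∑ k ∈ S n, a n k := by
    intro n
    have hp : (0 : ℝ) ≤ 2 / n := by positivity
    simp only [hG]
    rw [integral_finsetSum, Finset.mul_sum]
    · refine Finset.sum_congr rfl fun k _ => ?_
      rw [integral_indicator_const _ measurableSet_Ico]
      simp [Measure.real, hp]
    · intro k _
      exact (integrable_indicator_iff measurableSet_Ico).2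
        (integrableOn_const (by simp))
  simp_rw [← hint]
  refine tendsto_integral_filter_of_dominated_convergence
    (fun y => C * Real.exp β * Real.exp (-(β / 2) * y ^ 2)) ?_ ?_ ?_ ?_
  · refine Eventually.of_forall fun n => ?_
    exact (Finset.measurable_sum _ fun k _ =>
      measurable_const.indicator measurableSet_Ico).aestronglyMeasurable
  · filter_upwards [hbound, eventually_ge_atTop 2] with n hb hn
    refine Eventually.of_forall fun y => ?_
    by_cases hy : ∃ k ∈ S n, y ∈ I n k
    · obtain ⟨k, hk, hky⟩ := hy
      rw [hGeq n (by omega) k hk y hky, Real.norm_eq_abs]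
      refine (hb k hk).trans ?_
      rw [mul_assoc, ← Real.exp_add]
      gcongr
      have hn' : (2 : ℝ) ≤ n := by exact_mod_cast hn
      have h2 : (2 : ℝ) / n ≤ 1 := (div_le_one (by linarith)).2 hn'
      obtain ⟨hy1, hy2⟩ := hky
      have : y ^ 2 ≤ 2 * mfScaled u n k ^ 2 + 2 := by
        nlinarith [sq_nonneg (y - 2 * mfScaled u n k)]
      nlinarith
    · push Not at hy
      have : G n y = 0 := Finset.sum_eq_zero fun k hk => Set.indicator_of_notMem (hy k hk) _
      rw [this, norm_zero]
      positivity
  · exact (integrable_exp_neg_mul_sq (half_pos hβ)).const_mul _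
  · refine Eventually.of_forall fun y => ?_
    refine (hlim y).congr' ?_
    filter_upwards [hmem y, eventually_mem_Ico_mfIndex h0 y, eventually_gt_atTop 0]
      with n hm hI' hn
    exact (hGeq n hn _ hm y hI').symm

lemma mfWeight_pos {α h : ℝ} {n k : ℕ} (hk : k < n * (n - 1) / 2 + 1) : 0 < mfWeight α h n k :=
  mul_pos (by exact_mod_cast Nat.choose_pos (Nat.lt_succ_iff.1 hk)) (Real.exp_pos _)

lemma gaussian_exponent_le {c μ x : ℝ} (hc : 0 < c) :
    |x| + c / 16 * (|x| + 2) ^ 2 - c * (x - μ) ^ 2 ≤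
      (c * μ ^ 2 + c / 2 + 2 / c) - c / 4 * x ^ 2 := by
  have h1 : x ^ 2 / 2 - μ ^ 2 ≤ (x - μ) ^ 2 := by nlinarith [sq_nonneg (x - 2 * μ)]
  have h2 : (|x| + 2) ^ 2 ≤ 2 * x ^ 2 + 8 := by nlinarith [sq_nonneg (|x| - 2), sq_abs x]
  have h3 : |x| ≤ c / 8 * x ^ 2 + 2 / c := by
    have : c / 8 * x ^ 2 + 2 / c - |x| = (c * |x| - 4) ^ 2 / (8 * c) := by
      rw [← sq_abs x]; field_simp; ring
    have h4 : 0 ≤ (c * |x| - 4) ^ 2 / (8 * c) := by positivity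
    linarith
  have h5 := mul_le_mul_of_nonneg_left h1 hc.le
  have h6 := mul_le_mul_of_nonneg_left h2 hc.le
  nlinarith

lemma tendsto_mfWeight_sum {α h u c μ δ C : ℝ} (h0 : 0 < u) (h1 : u < 1)
    (hcrit : Real.log (1 - u) - Real.log u + α * u ^ 2 + h = 0)
    (hc : c = (1 - 2 * α * u ^ 2 * (1 - u)) / (4 * u * (1 - u))) (hc0 : 0 < c)
    (hμ : 4 * c * μ = -(1 / (1 - u))) (hδ : 0 < δ) (hδ1 : δ < 1)
    (ψ : ℕ → ℕ → ℝ) (Ψ : ℝ → ℝ)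
    (hψ : ∀ᶠ n in atTop, ∀ k ∈ mfWindow δ u n, |ψ n k| ≤ C * Real.exp |mfScaled u n k|)
    (hlim : ∀ y, Tendsto (fun n => ψ n (mfIndex u y n)) atTop (nhds (Ψ y))) :
    Tendsto (fun n : ℕ => 2 / (n : ℝ) * Real.exp (-mfLogError α h c μ u n (mfIndex u 0 n)) *
        ∑ k ∈ mfWindow δ u n, ψ n k * mfWeight α h n k) atTop
      (nhds (∫ y, Ψ y * Real.exp (-c * (y - μ) ^ 2))) := by
  set E : ℕ → ℕ → ℝ := fun n k =>
    mfLogError α h c μ u n k - mfLogError α h c μ u n (mfIndex u 0 n) with hE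
  have hEb := fun η hη =>
    mfLogError_bound (η := η) (α := α) (h := h) h0 h1 hcrit hc hμ hδ hδ1 hη
  have hmem := eventually_mfIndex_mem h0 h1 hδ1
  have hElim : ∀ y, Tendsto (fun n => E n (mfIndex u y n)) atTop (nhds 0) := by
    intro y
    rw [Metric.tendsto_nhds]
    intro ε hε
    have hpos : 0 < (|y| + 3) ^ 2 := by positivity
    filter_upwards [hEb (ε / 2 / (|y| + 3) ^ 2) (by positivity), hmem y,
      (tendsto_mfScaled_mfIndex h0 y).abs.eventually_lt_const (lt_add_one |y|)]
      with n hb hm hx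
    rw [Real.dist_eq, sub_zero]
    refine (hb _ hm).trans_lt ?_
    have h5 : |mfScaled u n (mfIndex u y n)| + 2 ≤ |y| + 3 := by linarith
    calc _ ≤ ε / 2 / (|y| + 3) ^ 2 * (|y| + 3) ^ 2 := by gcongr
      _ = ε / 2 := by field_simp
      _ < ε := half_lt_self hε
  have hC : 0 ≤ C := by
    obtain ⟨n, hn, hm⟩ := (hψ.and (hmem 0)).exists
    exact nonneg_of_mul_nonneg_left ((abs_nonneg _).trans (hn _ hm)) (Real.exp_pos _)
  have main := tendsto_sum_mfScaled (u := u) (C := C * Real.exp (c * μ ^ 2 + c / 2 + 2 / c))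
    (β := c / 4) h0 (by positivity) (mfWindow δ u)
    (fun n k => ψ n k * (Real.exp (E n k) * Real.exp (-c * (mfScaled u n k - μ) ^ 2)))
    (fun y => Ψ y * Real.exp (-c * (y - μ) ^ 2)) (by positivity) ?_ ?_ hmem
  · refine main.congr fun n => ?_
    rw [mul_assoc]
    congr 1
    rw [Finset.mul_sum]
    refine Finset.sum_congr rfl fun k hk => ?_
    have hW : mfWeight α h n k =
        Real.exp (mfLogError α h c μ u n k + -c * (mfScaled u n k - μ) ^ 2) := by
      rw [mfLogError, show ∀ a b : ℝ, a + c * b + -c * b = a by intros; ring,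
        Real.exp_log (mfWeight_pos (mem_mfWindow.1 hk).1)]
    rw [hW, ← Real.exp_add, mul_left_comm, ← Real.exp_add]
    simp only [hE]
    congr 2
    ring
  · filter_upwards [hψ, hEb (c / 16) (by positivity)] with n hψn hEn k hk
    rw [abs_mul, ← Real.exp_add, Real.abs_exp]
    calc _ ≤ C * Real.exp |mfScaled u n k| *
          Real.exp (E n k + -c * (mfScaled u n k - μ) ^ 2) := by
          gcongr
          exact hψn k hk
      _ = C * Real.exp (|mfScaled u n k| + E n k - c * (mfScaled u n k - μ) ^ 2) := by
          rw [mul_assoc, ← Real.exp_add]; congr 2; ring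
      _ ≤ C * Real.exp ((c * μ ^ 2 + c / 2 + 2 / c) + -(c / 4) * mfScaled u n k ^ 2) := by
          gcongr
          have := gaussian_exponent_le (μ := μ) (x := mfScaled u n k) hc0
          have := (le_abs_self _).trans (hEn k hk)
          simp only [hE]
          linarith
      _ = _ := by rw [Real.exp_add]; ring
  · intro y
    have hx := tendsto_mfScaled_mfIndex h0 y
    have := (hlim y).mul ((Real.continuous_exp.continuousAt.tendsto.comp (hElim y)).mul
      (Real.continuous_exp.continuousAt.tendsto.comp
        (tendsto_const_nhds (x := -c) |>.mul ((hx.sub_const μ).pow 2))))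
    simpa using this

lemma integral_exp_neg_mul_sub_sq (c μ : ℝ) :
    ∫ y, Real.exp (-c * (y - μ) ^ 2) = Real.sqrt (Real.pi / c) := by
  rw [integral_sub_right_eq_self (fun y => Real.exp (-c * y ^ 2)) μ, integral_gaussian]

lemma tendsto_mfWeight_ratio {α h u c μ δ C : ℝ} (h0 : 0 < u) (h1 : u < 1)
    (hcrit : Real.log (1 - u) - Real.log u + α * u ^ 2 + h = 0)
    (hc : c = (1 - 2 * α * u ^ 2 * (1 - u)) / (4 * u * (1 - u))) (hc0 : 0 < c)
    (hμ : 4 * c * μ = -(1 / (1 - u))) (hδ : 0 < δ) (hδ1 : δ < 1)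
    (ψ : ℕ → ℕ → ℝ) (Ψ : ℝ → ℝ)
    (hψ : ∀ᶠ n in atTop, ∀ k ∈ mfWindow δ u n, |ψ n k| ≤ C * Real.exp |mfScaled u n k|)
    (hlim : ∀ y, Tendsto (fun n => ψ n (mfIndex u y n)) atTop (nhds (Ψ y))) :
    Tendsto (fun n : ℕ => (∑ k ∈ mfWindow δ u n, ψ n k * mfWeight α h n k) /
        ∑ k ∈ mfWindow δ u n, mfWeight α h n k) atTop
      (nhds ((∫ y, Ψ y * Real.exp (-c * (y - μ) ^ 2)) / Real.sqrt (Real.pi / c))) := by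
  have hnum := tendsto_mfWeight_sum h0 h1 hcrit hc hc0 hμ hδ hδ1 ψ Ψ hψ hlim
  have hden := tendsto_mfWeight_sum (C := 1) h0 h1 hcrit hc hc0 hμ hδ hδ1 (fun _ _ => 1)
    (fun _ => 1) (Eventually.of_forall fun n k _ => by simp) (fun _ => tendsto_const_nhds)
  simp only [one_mul] at hden
  rw [integral_exp_neg_mul_sub_sq] at hden
  refine (hnum.div hden (Real.sqrt_pos.2 (by positivity)).ne').congr' ?_
  filter_upwards [eventually_gt_atTop 0] with n hn
  have hn' : (0 : ℝ) < n := by exact_mod_cast hn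
  exact mul_div_mul_left _ _ (by positivity)

lemma mfCondExp_mfBall (α h δ u : ℝ) (n : ℕ) (f : ℝ → ℝ) :
    mfCondExp α h n (mfBall n δ u) f =
      (∑ k ∈ mfWindow δ u n, f (mfDensity n k) * mfWeight α h n k) /
        ∑ k ∈ mfWindow δ u n, mfWeight α h n k := by
  rw [mfCondExp, mfWindow, Finset.sum_filter, Finset.sum_filter]

/-- The scaled cubic fluctuation `n (m³ - u³)`. -/
noncomputable def mfCubic (u : ℝ) (n k : ℕ) : ℝ := n * (mfDensity n k ^ 3 - u ^ 3)

lemma tendsto_mfCubic {u : ℝ} (h0 : 0 < u) (y : ℝ) :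
    Tendsto (fun n => mfCubic u n (mfIndex u y n)) atTop (nhds (3 * u ^ 2 * y)) := by
  have hx := tendsto_mfScaled_mfIndex h0 y
  have hm : Tendsto (fun n => mfDensity n (mfIndex u y n)) atTop (nhds u) := by
    have := (hx.mul (tendsto_one_div_atTop_nhds_zero_nat (𝕜 := ℝ))).add_const u
    rw [mul_zero, zero_add] at this
    refine this.congr' ?_
    filter_upwards [eventually_gt_atTop 0] with n hn
    have hn' : (0 : ℝ) < n := by exact_mod_cast hn
    rw [mfScaled]; field_simp; ring
  have := hx.mul (((hm.pow 2).add (hm.mul_const u)).add_const (u ^ 2))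
  rw [show y * (u ^ 2 + u * u + u ^ 2) = 3 * u ^ 2 * y by ring] at this
  refine this.congr fun n => ?_
  rw [mfScaled, mfCubic]; ring

lemma mfCubic_bound {u δ : ℝ} (h0 : 0 < u) (h1 : u < 1) (hδ : 0 < δ) :
    ∀ᶠ n in atTop, ∀ k ∈ mfWindow δ u n, |mfCubic u n k| ≤ 7 * Real.exp |mfScaled u n k| := by
  filter_upwards [(tendsto_natCast_rpow_neg hδ).eventually_lt_const one_pos] with n hn k hk
  have hm := abs_le.1 ((mem_mfWindow.1 hk).2.trans hn.le)
  have e : mfCubic u n k =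
      (mfDensity n k ^ 2 + mfDensity n k * u + u ^ 2) * mfScaled u n k := by
    rw [mfScaled, mfCubic]; ring
  rw [e, abs_mul]
  have hp : 0 ≤ mfDensity n k := by unfold mfDensity; positivity
  have h7 : |mfDensity n k ^ 2 + mfDensity n k * u + u ^ 2| ≤ 7 := by
    rw [abs_of_nonneg (by positivity)]
    nlinarith
  have := Real.add_one_le_exp |mfScaled u n k|
  gcongr
  linarith

lemma integral_mul_exp_neg_mul_sub_sq {c : ℝ} (hc : 0 < c) (μ b : ℝ) :
    ∫ y, b * y * Real.exp (-c * (y - μ) ^ 2) = b * μ * Real.sqrt (Real.pi / c) := by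
  have hodd : ∫ z, z * Real.exp (-c * z ^ 2) = 0 := by
    have := integral_neg_eq_self (fun z : ℝ => z * Real.exp (-c * z ^ 2)) volume
    simp only [neg_sq, neg_mul, integral_neg] at this
    simp only [neg_mul]
    linarith
  have hshift := integral_sub_right_eq_self
    (fun z : ℝ => b * (z + μ) * Real.exp (-c * z ^ 2)) (μ := volume) μ
  simp only [sub_add_cancel] at hshift
  have e : ∀ z : ℝ, b * (z + μ) * Real.exp (-c * z ^ 2) =
      b * (z * Real.exp (-c * z ^ 2)) + b * μ * Real.exp (-c * z ^ 2) := fun z => by ring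
  rw [hshift]
  simp_rw [e]
  rw [integral_add ((integrable_mul_exp_neg_mul_sq hc).const_mul b)
    ((integrable_exp_neg_mul_sq hc).const_mul _), integral_const_mul, integral_const_mul, hodd,
    integral_gaussian, mul_zero, zero_add]

lemma integral_comp_affine_gaussian {a c : ℝ} (ha : 0 < a) (hc : 0 < c) (μ : ℝ) (φ : ℝ → ℝ) :
    (∫ y, φ (a * (y - μ)) * Real.exp (-c * (y - μ) ^ 2)) / Real.sqrt (Real.pi / c) =
      ∫ y, φ y * ((Real.sqrt (2 * Real.pi * (a ^ 2 / (2 * c))))⁻¹ *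
        Real.exp (-(y ^ 2) / (2 * (a ^ 2 / (2 * c))))) := by
  rw [integral_sub_right_eq_self (fun z => φ (a * z) * Real.exp (-c * z ^ 2)) μ]
  have hscale := Measure.integral_comp_mul_left
    (fun y => φ y * Real.exp (-(y ^ 2) / (2 * (a ^ 2 / (2 * c))))) a
  have e : ∀ z : ℝ, -((a * z) ^ 2) / (2 * (a ^ 2 / (2 * c))) = -c * z ^ 2 := fun z => by
    field_simp
  simp only [e] at hscale
  have hs : Real.sqrt (2 * Real.pi * (a ^ 2 / (2 * c))) = a * Real.sqrt (Real.pi / c) := by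
    rw [show 2 * Real.pi * (a ^ 2 / (2 * c)) = a ^ 2 * (Real.pi / c) by field_simp,
      Real.sqrt_mul (sq_nonneg a), Real.sqrt_sq ha.le]
  rw [hscale, hs, abs_of_pos (inv_pos.2 ha), smul_eq_mul]
  simp_rw [mul_left_comm (φ _)]
  rw [integral_const_mul, mul_inv]
  ring

/-- The conditional central limit theorem around a single nondegenerate interior maximizer. -/
theorem mfCondExp_tendsto_gaussian {α h u δ : ℝ} (h0 : 0 < u) (h1 : u < 1)
    (hmax : ∀ v ∈ Set.Icc (0 : ℝ) 1, gFun α h v ≤ gFun α h u) {c : ℝ}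
    (hc : c = (1 - 2 * α * u ^ 2 * (1 - u)) / (4 * u * (1 - u))) (hc0 : 0 < c)
    (hδ : 0 < δ) (hδ1 : δ < 1) {φ : ℝ → ℝ} (hφ : Continuous φ) {M : ℝ} (hM : ∀ x, |φ x| ≤ M) :
    Tendsto
      (fun n : ℕ => mfCondExp α h n (mfBall n δ u)
        (fun m => φ ((n : ℝ) *
          (m ^ 3 - mfCondExp α h n (mfBall n δ u) (fun m' => m' ^ 3)) / Real.sqrt 6)))
      atTop
      (nhds (∫ y : ℝ, φ y * ((Real.sqrt (2 * Real.pi * (3 * u ^ 4 / (4 * c))))⁻¹ *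
        Real.exp (-(y ^ 2) / (2 * (3 * u ^ 4 / (4 * c))))))) := by
  have hcrit := gFun_critical h0 h1 hmax
  obtain ⟨μ, hμ⟩ : ∃ μ, 4 * c * μ = -(1 / (1 - u)) :=
    ⟨-(1 / (1 - u)) / (4 * c), by field_simp⟩
  have hsqrt : 0 < Real.sqrt (Real.pi / c) := Real.sqrt_pos.2 (by positivity)
  set T : ℕ → ℝ := fun n => (∑ k ∈ mfWindow δ u n, mfCubic u n k * mfWeight α h n k) /
    ∑ k ∈ mfWindow δ u n, mfWeight α h n k with hT
  have hTlim : Tendsto T atTop (nhds (3 * u ^ 2 * μ)) := by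
    have := tendsto_mfWeight_ratio h0 h1 hcrit hc hc0 hμ hδ hδ1 (mfCubic u)
      (fun y => 3 * u ^ 2 * y) (mfCubic_bound h0 h1 hδ) (tendsto_mfCubic h0)
    rwa [integral_mul_exp_neg_mul_sub_sq hc0, mul_div_cancel_right₀ _ hsqrt.ne'] at this
  have hmean : ∀ᶠ n : ℕ in atTop, ∀ k,
      (n : ℝ) * (mfDensity n k ^ 3 - mfCondExp α h n (mfBall n δ u) (fun m' => m' ^ 3)) =
        mfCubic u n k - T n := by
    filter_upwards [eventually_mfIndex_mem h0 h1 hδ1 0] with n hm k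
    have hZ : 0 < ∑ k ∈ mfWindow δ u n, mfWeight α h n k :=
      Finset.sum_pos (fun k hk => mfWeight_pos (mem_mfWindow.1 hk).1) ⟨_, hm⟩
    have hTn : T n = n * (mfCondExp α h n (mfBall n δ u) (fun m' => m' ^ 3) - u ^ 3) := by
      rw [mfCondExp_mfBall, div_sub' hZ.ne', ← mul_div_assoc]
      simp only [hT]
      congr 1
      rw [Finset.sum_mul, ← Finset.sum_sub_distrib, Finset.mul_sum]
      refine Finset.sum_congr rfl fun k _ => ?_
      rw [mfCubic]; ring
    rw [hTn, mfCubic]; ring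
  have main := tendsto_mfWeight_ratio (C := M) h0 h1 hcrit hc hc0 hμ hδ hδ1
    (fun n k => φ ((mfCubic u n k - T n) / Real.sqrt 6))
    (fun y => φ (3 * u ^ 2 / Real.sqrt 6 * (y - μ)))
    (Eventually.of_forall fun n k _ => (hM _).trans <|
      le_mul_of_one_le_right ((abs_nonneg _).trans (hM 0)) (Real.one_le_exp (abs_nonneg _)))
    (fun y => by
      have := ((tendsto_mfCubic h0 y).sub hTlim).div_const (Real.sqrt 6)
      rw [show (3 * u ^ 2 * y - 3 * u ^ 2 * μ) / Real.sqrt 6 =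
        3 * u ^ 2 / Real.sqrt 6 * (y - μ) by ring] at this
      exact (hφ.tendsto _).comp this)
  rw [integral_comp_affine_gaussian (by positivity) hc0,
    show (3 * u ^ 2 / Real.sqrt 6) ^ 2 / (2 * c) = 3 * u ^ 4 / (4 * c) by
      rw [div_pow, Real.sq_sqrt (by norm_num)]; field_simp; ring] at main
  refine main.congr' ?_
  filter_upwards [hmean] with n hn
  rw [mfCondExp_mfBall]
  simp only [hn]

/-- Conditional CLT on the critical curve: under the conditional measure given
`B_{u_i*}(n,δ)` with `δ ∈ (1/2, 1)`, the law of `n·(m³ − m̂_n^{(i)})/√6` converges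
weakly to `𝒩(0, 3(u_i*)⁴/(4c_i))`, for `i = 1, 2`. -/
theorem meanField_conditional_CLT
    (α h : ℝ) (hα : α > -2) (u₁ u₂ : ℝ)
    (h0 : 0 < u₁) (h12 : u₁ < u₂) (h1 : u₂ < 1)
    (hmax : ∀ u ∈ Set.Icc (0 : ℝ) 1, gFun α h u ≤ gFun α h u₁)
    (heq : gFun α h u₂ = gFun α h u₁)
    (huniq : ∀ u ∈ Set.Icc (0 : ℝ) 1, gFun α h u = gFun α h u₁ → u = u₁ ∨ u = u₂)
    (hc : ∀ u ∈ ({u₁, u₂} : Set ℝ),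
      0 < (1 - 2 * α * u ^ 2 * (1 - u)) / (4 * u * (1 - u)))
    (δ : ℝ) (hδ : δ ∈ Set.Ioo (1 / 2 : ℝ) 1) :
    ∀ u ∈ ({u₁, u₂} : Set ℝ), ∀ φ : ℝ → ℝ, Continuous φ → (∃ M : ℝ, ∀ x, |φ x| ≤ M) →
      Tendsto
        (fun n : ℕ => mfCondExp α h n (mfBall n δ u)
          (fun m => φ ((n : ℝ) *
            (m ^ 3 - mfCondExp α h n (mfBall n δ u) (fun m' => m' ^ 3)) / Real.sqrt 6)))
        atTop
        (nhds (∫ y : ℝ, φ y *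
          ((Real.sqrt (2 * Real.pi *
              (3 * u ^ 4 / (4 * ((1 - 2 * α * u ^ 2 * (1 - u)) / (4 * u * (1 - u)))))))⁻¹ *
            Real.exp (-(y ^ 2) /
              (2 * (3 * u ^ 4 /
                (4 * ((1 - 2 * α * u ^ 2 * (1 - u)) / (4 * u * (1 - u)))))))))) := by
  rintro u hu φ hφ ⟨M, hM⟩
  have hu' : gFun α h u = gFun α h u₁ := by
    rcases hu with rfl | rfl
    exacts [rfl, heq]
  have h01 : 0 < u ∧ u < 1 := by
    rcases hu with rfl | rfl
    exacts [⟨h0, h12.trans h1⟩, ⟨h0.trans h12, h1⟩]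
  exact mfCondExp_tendsto_gaussian h01.1 h01.2 (fun v hv => hu' ▸ hmax v hv) rfl (hc u hu)
    (by linarith [hδ.1]) hδ.2 hφ hM
end
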